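/- arXiv:1911.03253 — 3 statements merged into one kernel-verified Lean document; each statement's English description precedes it below -/
import Mathlib

section
/- Let s < −1/2 and 1/2 < b ≤ 1. Then for every constant C > 0 there exist Schwartz functions u₁, u₂, u₃ on ℝ_t × ℝ_x such that ‖u₁ · conj(u₂) · u₃‖_{X^{s,b−1}} > C ‖u₁‖_{X^{s,b}} ‖u₂‖_{X^{s,b}} ‖u₃‖_{X^{s,b}}, where conj denotes complex conjugation; that is, the trilinear estimate fails for s < −1/2. -/
open MeasureTheory Complex
open scoped ENNReal

/-- The space-time Fourier transform `ũ(τ,ξ) = ∫∫ e^{-i(tτ+xξ)} u(t,x) dt dx`. -/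
noncomputable def spaceTimeFT (u : ℝ × ℝ → ℂ) (τ ξ : ℝ) : ℂ :=
  ∫ p : ℝ × ℝ, Complex.exp (-(Complex.I * (p.1 * τ + p.2 * ξ))) * u p

/-- The Bourgain norm `‖u‖_{X^{s,b}} = ‖⟨ξ⟩^s ⟨τ+ξ⁴⟩^b ũ(τ,ξ)‖_{L²_{τ,ξ}}`. -/
noncomputable def Xnorm (s b : ℝ) (u : ℝ × ℝ → ℂ) : ℝ≥0∞ :=
  eLpNorm (fun q : ℝ × ℝ =>
    (((1 + q.2^2) ^ (s/2) * (1 + (q.1 + q.2^4)^2) ^ (b/2) : ℝ) : ℂ) *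
      spaceTimeFT u q.1 q.2) 2 volume

open scoped ContDiff

/-- The one-dimensional Fourier transform `∫ e^{-itσ} f(t) dt`. -/
noncomputable def angularFT (f : ℝ → ℂ) (σ : ℝ) : ℂ :=
  ∫ t : ℝ, Complex.exp (-(Complex.I * (t * σ))) * f t

/-- A wave packet at frequency `N`, of frequency width `1 / N`, travelling along the tangent line
of the curve `τ = -ξ⁴` at `ξ = N`. -/
noncomputable def wavePacket (N : ℝ) (f : ℝ → ℂ) (p : ℝ × ℝ) : ℂ :=
  Complex.exp (Complex.I * (p.2 * N - p.1 * N ^ 4)) * (f p.1 * f ((p.2 - 4 * N ^ 3 * p.1) / N))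

theorem angularFT_eq_fourier (f : ℝ → ℂ) (σ : ℝ) :
    angularFT f σ = FourierTransform.fourier f (σ / (2 * Real.pi)) := by
  rw [Real.fourier_real_eq_integral_exp_smul, angularFT]
  congr 1; ext t
  rw [smul_eq_mul]
  congr 2
  have : (Real.pi : ℂ) ≠ 0 := by exact_mod_cast Real.pi_ne_zero
  push_cast
  field_simp

theorem contDiff_wavePacket (N : ℝ) {f : ℝ → ℂ} (hf : ContDiff ℝ ∞ f) :
    ContDiff ℝ ∞ (wavePacket N f) := by
  unfold wavePacket
  have h1 : ContDiff ℝ ∞ fun p : ℝ × ℝ => (p.1 : ℂ) := Complex.ofRealCLM.contDiff.comp contDiff_fst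
  have h2 : ContDiff ℝ ∞ fun p : ℝ × ℝ => (p.2 : ℂ) := Complex.ofRealCLM.contDiff.comp contDiff_snd
  refine ContDiff.mul ?_ (ContDiff.mul (hf.comp contDiff_fst) (hf.comp ?_))
  · exact (contDiff_const.mul ((h2.mul contDiff_const).sub (h1.mul contDiff_const))).cexp
  · exact (contDiff_snd.sub (contDiff_const.mul contDiff_fst)).div_const _

theorem hasCompactSupport_wavePacket {N : ℝ} (hN : 0 < N) {f : ℝ → ℂ} (hf : HasCompactSupport f) :
    HasCompactSupport (wavePacket N f) := by
  have hK : IsCompact (tsupport f ×ˢ tsupport f) := hf.isCompact.prod hf.isCompact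
  refine HasCompactSupport.of_support_subset_isCompact
    (hK.image (f := fun q : ℝ × ℝ => (q.1, N * q.2 + 4 * N ^ 3 * q.1)) (by fun_prop)) ?_
  intro p hp
  have h : f p.1 * f ((p.2 - 4 * N ^ 3 * p.1) / N) ≠ 0 := right_ne_zero_of_mul hp
  refine ⟨(p.1, (p.2 - 4 * N ^ 3 * p.1) / N),
    ⟨subset_tsupport _ (left_ne_zero_of_mul h), subset_tsupport _ (right_ne_zero_of_mul h)⟩, ?_⟩
  ext
  · rfl
  · simp; field_simp; ring

theorem spaceTimeFT_wavePacket {N : ℝ} (hN : 0 < N) {f : ℝ → ℂ} (hf : Continuous f)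
    (hfc : HasCompactSupport f) (τ ξ : ℝ) :
    spaceTimeFT (wavePacket N f) τ ξ =
      N * (angularFT f (τ + N ^ 4 + 4 * N ^ 3 * (ξ - N)) * angularFT f (N * (ξ - N))) := by
  have hc : Continuous (wavePacket N f) := by unfold wavePacket; fun_prop
  have hint : Integrable (fun p : ℝ × ℝ =>
      Complex.exp (-(Complex.I * (p.1 * τ + p.2 * ξ))) * wavePacket N f p) :=
    Continuous.integrable_of_hasCompactSupport (by fun_prop)
      (hasCompactSupport_wavePacket hN hfc).mul_left
  have hN' : (N : ℂ) ≠ 0 := by exact_mod_cast hN.ne'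
  have inner (t : ℝ) : ∫ x : ℝ, Complex.exp (-(Complex.I * (t * τ + x * ξ))) *
      wavePacket N f (t, x) =
      Complex.exp (-(Complex.I * (t * (τ + N ^ 4 + 4 * N ^ 3 * (ξ - N) : ℝ)))) * f t *
        (N * angularFT f (N * (ξ - N))) := by
    set h : ℝ → ℂ := fun y => Complex.exp (-(Complex.I * (t * (τ + N ^ 4 + 4 * N ^ 3 * (ξ - N) : ℝ))))
      * f t * (Complex.exp (-(Complex.I * (y * (N * (ξ - N) : ℝ)))) * f y) with hh
    have e1 : (fun x : ℝ => Complex.exp (-(Complex.I * (t * τ + x * ξ))) * wavePacket N f (t, x))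
        = fun x => h ((x - 4 * N ^ 3 * t) / N) := by
      ext x
      simp only [hh, wavePacket]
      have hE : Complex.exp (-(Complex.I * (t * τ + x * ξ))) *
            Complex.exp (Complex.I * (x * N - t * N ^ 4)) =
          Complex.exp (-(Complex.I * (t * (τ + N ^ 4 + 4 * N ^ 3 * (ξ - N) : ℝ)))) *
            Complex.exp (-(Complex.I * (((x - 4 * N ^ 3 * t) / N : ℝ) * (N * (ξ - N) : ℝ)))) := by
        rw [← Complex.exp_add, ← Complex.exp_add]
        congr 1
        push_cast
        field_simp
        ring
      linear_combination f t * f ((x - 4 * N ^ 3 * t) / N) * hE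
    rw [e1, integral_sub_right_eq_self (fun x => h (x / N)), Measure.integral_comp_div h N,
      abs_of_pos hN, hh, integral_const_mul, ← angularFT, Complex.real_smul]
    ring
  unfold spaceTimeFT
  rw [Measure.volume_eq_prod, integral_prod _ hint]
  simp only [inner]
  rw [integral_mul_const, ← angularFT]
  ring

theorem lintegral_comp_tangent_coords {N : ℝ} (hN : 0 < N) {G : ℝ × ℝ → ℝ≥0∞} (hG : Measurable G) :
    ∫⁻ q : ℝ × ℝ, G (q.1 + N ^ 4 + 4 * N ^ 3 * (q.2 - N), N * (q.2 - N)) =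
      ENNReal.ofReal N⁻¹ * ∫⁻ q, G q := by
  have hm : Measurable fun η : ℝ => ∫⁻ σ : ℝ, G (σ, η) := hG.lintegral_prod_left'
  rw [Measure.volume_eq_prod, lintegral_prod_symm' _ (by fun_prop), lintegral_prod_symm' _ hG]
  have e1 (ξ : ℝ) : ∫⁻ τ : ℝ, G (τ + N ^ 4 + 4 * N ^ 3 * (ξ - N), N * (ξ - N)) =
      ∫⁻ σ : ℝ, G (σ, N * (ξ - N)) := by
    simp only [add_assoc]
    exact lintegral_add_right_eq_self (fun σ => G (σ, N * (ξ - N))) _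
  simp only [e1]
  rw [lintegral_sub_right_eq_self (fun ξ => ∫⁻ σ : ℝ, G (σ, N * ξ)),
    ← abs_of_pos (inv_pos.2 hN), ← smul_eq_mul, ← lintegral_smul_measure,
    ← Real.map_volume_mul_left hN.ne', lintegral_map hm (by fun_prop)]

theorem continuous_angularFT {f : ℝ → ℂ} (hf : ContDiff ℝ ∞ f) (hfc : HasCompactSupport f) :
    Continuous (angularFT f) := by
  have : angularFT f = fun σ => FourierTransform.fourier (hfc.toSchwartzMap hf)
      (σ / (2 * Real.pi)) := by
    ext σ
    rw [angularFT_eq_fourier, SchwartzMap.fourier_coe]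
    rfl
  rw [this]
  fun_prop

theorem lintegral_weight_angularFT_lt_top {f : ℝ → ℂ} (hf : ContDiff ℝ ∞ f)
    (hfc : HasCompactSupport f) (r : ℝ) :
    ∫⁻ σ : ℝ, ENNReal.ofReal ((1 + σ ^ 2) ^ r * ‖angularFT f σ‖ ^ 2) < ⊤ := by
  set g := FourierTransform.fourier (hfc.toSchwartzMap hf) with hg
  obtain ⟨k, hk⟩ := exists_nat_ge (r + 1)
  obtain ⟨A, hA⟩ : ∃ A : ℝ, ∀ x, (1 + ‖x‖) ^ k * ‖g x‖ ≤ A := by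
    refine ⟨2 ^ k * (Finset.Iic (k, 0)).sup (fun m => SchwartzMap.seminorm ℝ m.1 m.2) g,
      fun x => ?_⟩
    simpa using SchwartzMap.one_add_le_sup_seminorm_apply (𝕜 := ℝ) (m := (k, 0)) le_rfl le_rfl g x
  have key (σ : ℝ) : (1 + σ ^ 2) ^ r * ‖angularFT f σ‖ ^ 2 ≤
      ((2 * Real.pi) ^ k * A) ^ 2 * (1 + σ ^ 2)⁻¹ := by
    have hpi : (1 : ℝ) ≤ 2 * Real.pi := by linarith [Real.pi_gt_three]
    have h1 : (1 + σ ^ 2) ^ r * (1 + σ ^ 2) ≤ ((1 + |σ|) ^ k) ^ 2 := by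
      have hle : (1 : ℝ) ≤ 1 + σ ^ 2 := by nlinarith
      calc (1 + σ ^ 2) ^ r * (1 + σ ^ 2) = (1 + σ ^ 2) ^ (r + 1) := by
            rw [Real.rpow_add (by positivity), Real.rpow_one]
        _ ≤ (1 + σ ^ 2) ^ (k : ℝ) := Real.rpow_le_rpow_of_exponent_le hle hk
        _ = (1 + σ ^ 2) ^ k := Real.rpow_natCast _ _
        _ ≤ ((1 + |σ|) ^ 2) ^ k := by
            gcongr
            nlinarith [abs_nonneg σ, sq_abs σ]
        _ = ((1 + |σ|) ^ k) ^ 2 := by rw [← pow_mul, ← pow_mul, mul_comm]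
    have h2 : (1 + |σ|) ^ k * ‖angularFT f σ‖ ≤ (2 * Real.pi) ^ k * A := by
      have h3 : angularFT f σ = g (σ / (2 * Real.pi)) := by
        rw [angularFT_eq_fourier, hg, SchwartzMap.fourier_coe]
        rfl
      have h4 : 1 + |σ| ≤ 2 * Real.pi * (1 + ‖σ / (2 * Real.pi)‖) := by
        rw [norm_div, Real.norm_eq_abs, Real.norm_eq_abs, abs_of_pos Real.two_pi_pos, mul_add,
          mul_div_cancel₀ _ Real.two_pi_pos.ne']
        linarith
      calc (1 + |σ|) ^ k * ‖angularFT f σ‖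
          ≤ (2 * Real.pi * (1 + ‖σ / (2 * Real.pi)‖)) ^ k * ‖g (σ / (2 * Real.pi))‖ := by
            rw [h3]; gcongr
        _ = (2 * Real.pi) ^ k * ((1 + ‖σ / (2 * Real.pi)‖) ^ k * ‖g (σ / (2 * Real.pi))‖) := by
            rw [mul_pow, mul_assoc]
        _ ≤ _ := by gcongr; exact hA _
    rw [← div_eq_mul_inv, le_div_iff₀ (by positivity)]
    calc (1 + σ ^ 2) ^ r * ‖angularFT f σ‖ ^ 2 * (1 + σ ^ 2)
        = (1 + σ ^ 2) ^ r * (1 + σ ^ 2) * ‖angularFT f σ‖ ^ 2 := by ring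
      _ ≤ ((1 + |σ|) ^ k) ^ 2 * ‖angularFT f σ‖ ^ 2 := by gcongr
      _ = ((1 + |σ|) ^ k * ‖angularFT f σ‖) ^ 2 := by ring
      _ ≤ _ := by gcongr
  calc ∫⁻ σ : ℝ, ENNReal.ofReal ((1 + σ ^ 2) ^ r * ‖angularFT f σ‖ ^ 2)
      ≤ ∫⁻ σ : ℝ, ENNReal.ofReal (((2 * Real.pi) ^ k * A) ^ 2 * (1 + σ ^ 2)⁻¹) :=
        lintegral_mono fun σ => ENNReal.ofReal_le_ofReal (key σ)
    _ < ⊤ := (integrable_inv_one_add_sq.const_mul _).lintegral_lt_top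

/-- The resonance weight in the coordinates adapted to the tangent line at `N`. -/
noncomputable def tangentWeight (s b N : ℝ) (q : ℝ × ℝ) : ℝ :=
  (1 + (N + q.2 / N) ^ 2) ^ s *
    (1 + (q.1 + 6 * q.2 ^ 2 + 4 * q.2 ^ 3 / N ^ 2 + q.2 ^ 4 / N ^ 4) ^ 2) ^ b

theorem tangentWeight_nonneg (s b N : ℝ) (q : ℝ × ℝ) : 0 ≤ tangentWeight s b N q := by
  unfold tangentWeight; positivity

theorem continuous_tangentWeight (s b N : ℝ) : Continuous (tangentWeight s b N) := by
  unfold tangentWeight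
  refine Continuous.mul (Continuous.rpow_const (by fun_prop) fun q => Or.inl (by positivity))
    (Continuous.rpow_const (by fun_prop) fun q => Or.inl (by positivity))

theorem Xnorm_wavePacket_sq (s b : ℝ) {N : ℝ} (hN : 0 < N) {f : ℝ → ℂ} (hf : ContDiff ℝ ∞ f)
    (hfc : HasCompactSupport f) :
    Xnorm s b (wavePacket N f) ^ 2 = ENNReal.ofReal N * ∫⁻ q : ℝ × ℝ,
      ENNReal.ofReal (tangentWeight s b N q * (‖angularFT f q.1‖ ^ 2 * ‖angularFT f q.2‖ ^ 2)) := by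
  have hF := continuous_angularFT hf hfc
  have hW := continuous_tangentWeight s b N
  have h2 := eLpNorm_nnreal_pow_eq_lintegral (μ := volume) (p := 2) (f := fun q : ℝ × ℝ =>
    (((1 + q.2^2) ^ (s/2) * (1 + (q.1 + q.2^4)^2) ^ (b/2) : ℝ) : ℂ) *
      spaceTimeFT (wavePacket N f) q.1 q.2) two_ne_zero
  rw [NNReal.coe_ofNat, ENNReal.coe_ofNat, ENNReal.rpow_ofNat] at h2
  rw [Xnorm, h2]
  have h3 (q : ℝ × ℝ) : ‖(((1 + q.2^2) ^ (s/2) * (1 + (q.1 + q.2^4)^2) ^ (b/2) : ℝ) : ℂ) *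
      spaceTimeFT (wavePacket N f) q.1 q.2‖ₑ ^ (2 : ℝ) =
      (fun p : ℝ × ℝ => ENNReal.ofReal (N ^ 2) * ENNReal.ofReal (tangentWeight s b N p *
        (‖angularFT f p.1‖ ^ 2 * ‖angularFT f p.2‖ ^ 2)))
        (q.1 + N ^ 4 + 4 * N ^ 3 * (q.2 - N), N * (q.2 - N)) := by
    beta_reduce
    rw [ENNReal.rpow_ofNat, ← ofReal_norm, ← ENNReal.ofReal_pow (norm_nonneg _),
      ← ENNReal.ofReal_mul (by positivity), norm_mul, Complex.norm_real,
      Real.norm_of_nonneg (by positivity), spaceTimeFT_wavePacket hN hf.continuous hfc, norm_mul,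
      norm_mul, Complex.norm_real, Real.norm_of_nonneg hN.le]
    congr 1
    have e1 : N + N * (q.2 - N) / N = q.2 := by field_simp; ring
    have e2 : q.1 + N ^ 4 + 4 * N ^ 3 * (q.2 - N) + 6 * (N * (q.2 - N)) ^ 2 +
        4 * (N * (q.2 - N)) ^ 3 / N ^ 2 + (N * (q.2 - N)) ^ 4 / N ^ 4 = q.1 + q.2 ^ 4 := by
      field_simp; ring
    have e3 (x r : ℝ) (hx : 0 < x) : (x ^ (r / 2)) ^ 2 = x ^ r := by
      rw [← Real.rpow_natCast, ← Real.rpow_mul hx.le]; norm_num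
    simp only [tangentWeight]
    rw [e1, e2, ← e3 _ s (by positivity), ← e3 _ b (by positivity)]
    ring
  rw [lintegral_congr h3, lintegral_comp_tangent_coords hN (G := fun p => ENNReal.ofReal (N ^ 2) *
      ENNReal.ofReal (tangentWeight s b N p * (‖angularFT f p.1‖ ^ 2 * ‖angularFT f p.2‖ ^ 2)))
      (by fun_prop), lintegral_const_mul _ (by fun_prop),
    ← mul_assoc, ← ENNReal.ofReal_mul (by positivity)]
  congr 2
  field_simp

theorem tangentWeight_le {s b N : ℝ} (hs : s ≤ 0) (hb1 : b ≤ 1) (hN : 1 ≤ N)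
    (q : ℝ × ℝ) : tangentWeight s b N q ≤
      (245 * 2 ^ (-s)) * (N ^ 2) ^ s * ((1 + q.1 ^ 2) ^ (1 : ℝ) * (1 + q.2 ^ 2) ^ (4 - s)) := by
  obtain ⟨σ, η⟩ := q
  simp only [tangentWeight]
  have hN0 : 0 < N := by linarith
  have h1 : (1 + (N + η / N) ^ 2) ^ s ≤ 2 ^ (-s) * (N ^ 2) ^ s * (1 + η ^ 2) ^ (-s) := by
    have hη : (η / N) ^ 2 ≤ η ^ 2 := by
      rw [div_pow]; exact div_le_self (sq_nonneg _) (one_le_pow₀ hN)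
    have h : N ^ 2 / (2 * (1 + η ^ 2)) ≤ 1 + (N + η / N) ^ 2 := by
      rw [div_le_iff₀ (by positivity)]
      nlinarith [sq_nonneg (N + 2 * (η / N)), mul_nonneg (sq_nonneg (N + η / N)) (sq_nonneg η)]
    calc (1 + (N + η / N) ^ 2) ^ s ≤ (N ^ 2 / (2 * (1 + η ^ 2))) ^ s :=
          Real.rpow_le_rpow_of_nonpos (by positivity) h hs
      _ = _ := by
          rw [Real.div_rpow (by positivity) (by positivity), Real.mul_rpow (by norm_num)
            (by positivity), Real.rpow_neg (by norm_num), Real.rpow_neg (by positivity)]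
          field_simp
  set a := 6 * η ^ 2 + 4 * η ^ 3 / N ^ 2 + η ^ 4 / N ^ 4 with ha
  have hsum : σ + 6 * η ^ 2 + 4 * η ^ 3 / N ^ 2 + η ^ 4 / N ^ 4 = σ + a := by rw [ha]; ring
  have habs : |a| ≤ 11 * (1 + η ^ 2) ^ 2 := by
    have h3 : |4 * η ^ 3 / N ^ 2| ≤ 4 * |η| ^ 3 := by
      rw [abs_div, abs_mul, abs_pow, abs_of_pos (by positivity : (0 : ℝ) < N ^ 2),
        abs_of_pos (by norm_num : (0 : ℝ) < 4)]
      exact div_le_self (by positivity) (one_le_pow₀ hN)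
    have h4 : |η ^ 4 / N ^ 4| ≤ η ^ 4 := by
      rw [abs_of_nonneg (by positivity)]
      exact div_le_self (by positivity) (one_le_pow₀ hN)
    have h5 : |6 * η ^ 2| = 6 * η ^ 2 := abs_of_nonneg (by positivity)
    have h6 : 4 * |η| ^ 3 ≤ 2 * η ^ 2 + 2 * η ^ 4 := by
      have : η ^ 2 = |η| ^ 2 := (sq_abs η).symm
      have : η ^ 4 = |η| ^ 4 := by rw [← abs_pow, abs_of_nonneg (by positivity)]
      nlinarith [mul_nonneg (sq_nonneg |η|) (sq_nonneg (|η| - 1))]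
    have h7 := abs_add_three (6 * η ^ 2) (4 * η ^ 3 / N ^ 2) (η ^ 4 / N ^ 4)
    nlinarith [sq_nonneg η, sq_nonneg (η ^ 2)]
  have h2 : (1 + (σ + a) ^ 2) ^ b ≤ 245 * ((1 + σ ^ 2) * (1 + η ^ 2) ^ 4) := by
    have hsq : a ^ 2 ≤ 121 * (1 + η ^ 2) ^ 4 := by
      calc a ^ 2 = |a| ^ 2 := (sq_abs a).symm
        _ ≤ (11 * (1 + η ^ 2) ^ 2) ^ 2 := by gcongr
        _ = _ := by ring
    have hE : (1 : ℝ) ≤ (1 + η ^ 2) ^ 4 := one_le_pow₀ (by nlinarith)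
    calc (1 + (σ + a) ^ 2) ^ b ≤ (1 + (σ + a) ^ 2) ^ (1 : ℝ) :=
          Real.rpow_le_rpow_of_exponent_le (by nlinarith [sq_nonneg (σ + a)]) hb1
      _ = 1 + (σ + a) ^ 2 := Real.rpow_one _
      _ ≤ _ := by
        nlinarith [sq_nonneg (σ - a), mul_nonneg (sq_nonneg σ) (by linarith : 0 ≤ (1 + η ^ 2) ^ 4),
          mul_nonneg (sq_nonneg σ) (by linarith : 0 ≤ (1 + η ^ 2) ^ 4 - 1)]
  rw [hsum, Real.rpow_one, sub_eq_add_neg, Real.rpow_add (by positivity)]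
  calc _ ≤ (2 ^ (-s) * (N ^ 2) ^ s * (1 + η ^ 2) ^ (-s)) *
        (245 * ((1 + σ ^ 2) * (1 + η ^ 2) ^ 4)) := by gcongr
    _ = _ := by
      rw [show ((1 : ℝ) + η ^ 2) ^ (4 : ℝ) = (1 + η ^ 2) ^ 4 from Real.rpow_natCast _ 4]
      ring

theorem le_tangentWeight {s b N : ℝ} (hs : s ≤ 0) (hb : b ≤ 0) (hN : 1 ≤ N) {q : ℝ × ℝ}
    (hq1 : q.1 ∈ Set.Icc (0 : ℝ) 1) (hq2 : q.2 ∈ Set.Icc (0 : ℝ) 1) :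
    5 ^ s * 145 ^ b * (N ^ 2) ^ s ≤ tangentWeight s b N q := by
  obtain ⟨σ, η⟩ := q
  obtain ⟨hσ0, hσ1⟩ := hq1
  obtain ⟨hη0, hη1⟩ := hq2
  simp only at hσ0 hσ1 hη0 hη1
  simp only [tangentWeight]
  have hN0 : 0 < N := by linarith
  have h1 : 5 ^ s * (N ^ 2) ^ s ≤ (1 + (N + η / N) ^ 2) ^ s := by
    rw [← Real.mul_rpow (by norm_num) (by positivity)]
    refine Real.rpow_le_rpow_of_nonpos (by positivity) ?_ hs
    have : η / N ≤ 1 := (div_le_one hN0).2 (by linarith)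
    have : 0 ≤ η / N := by positivity
    nlinarith
  have h2 : (145 : ℝ) ^ b ≤
      (1 + (σ + 6 * η ^ 2 + 4 * η ^ 3 / N ^ 2 + η ^ 4 / N ^ 4) ^ 2) ^ b := by
    refine Real.rpow_le_rpow_of_nonpos (by positivity) ?_ hb
    have a2 : η ^ 2 ≤ 1 := pow_le_one₀ hη0 hη1
    have a3 : 4 * η ^ 3 / N ^ 2 ≤ 4 * η ^ 3 := div_le_self (by positivity) (one_le_pow₀ hN)
    have a4 : η ^ 4 / N ^ 4 ≤ η ^ 4 := div_le_self (by positivity) (one_le_pow₀ hN)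
    have a5 : η ^ 3 ≤ 1 := pow_le_one₀ hη0 hη1
    have a6 : η ^ 4 ≤ 1 := pow_le_one₀ hη0 hη1
    have hle : σ + 6 * η ^ 2 + 4 * η ^ 3 / N ^ 2 + η ^ 4 / N ^ 4 ≤ 12 := by linarith
    have := pow_le_pow_left₀ (by positivity) hle 2
    linarith
  calc _ = (5 ^ s * (N ^ 2) ^ s) * (145 : ℝ) ^ b := by ring
    _ ≤ _ := by gcongr

theorem exists_Xnorm_wavePacket_sq_le {s b : ℝ} (hs : s ≤ 0) (hb1 : b ≤ 1)
    {f : ℝ → ℂ} (hf : ContDiff ℝ ∞ f) (hfc : HasCompactSupport f) :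
    ∃ K : ℝ, 0 ≤ K ∧ ∀ N : ℝ, 1 ≤ N →
      Xnorm s b (wavePacket N f) ^ 2 ≤ ENNReal.ofReal (K * (N * (N ^ 2) ^ s)) := by
  have hF := continuous_angularFT hf hfc
  set I : ℝ → ℝ≥0∞ := fun r => ∫⁻ σ : ℝ, ENNReal.ofReal ((1 + σ ^ 2) ^ r * ‖angularFT f σ‖ ^ 2)
    with hI
  have hfin (r : ℝ) : I r ≠ ⊤ := (lintegral_weight_angularFT_lt_top hf hfc r).ne
  have hc (r : ℝ) : Continuous fun σ : ℝ => (1 + σ ^ 2) ^ r :=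
    Continuous.rpow_const (by fun_prop) fun σ => Or.inl (by positivity)
  have hc1 := hc 1
  have hc2 := hc (4 - s)
  refine ⟨(245 * 2 ^ (-s)) * (I 1 * I (4 - s)).toReal, by positivity, fun N hN => ?_⟩
  have hN0 : 0 < N := by linarith
  rw [Xnorm_wavePacket_sq s b hN0 hf hfc]
  have hprod : ∫⁻ q : ℝ × ℝ, ENNReal.ofReal ((1 + q.1 ^ 2) ^ (1 : ℝ) * ‖angularFT f q.1‖ ^ 2) *
      ENNReal.ofReal ((1 + q.2 ^ 2) ^ (4 - s) * ‖angularFT f q.2‖ ^ 2) = I 1 * I (4 - s) := by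
    rw [Measure.volume_eq_prod]
    exact lintegral_prod_mul
      (f := fun σ : ℝ => ENNReal.ofReal ((1 + σ ^ 2) ^ (1 : ℝ) * ‖angularFT f σ‖ ^ 2))
      (g := fun σ : ℝ => ENNReal.ofReal ((1 + σ ^ 2) ^ (4 - s) * ‖angularFT f σ‖ ^ 2))
      (Measurable.aemeasurable (by fun_prop)) (Measurable.aemeasurable (by fun_prop))
  calc _ ≤ ENNReal.ofReal N * ∫⁻ q : ℝ × ℝ, ENNReal.ofReal ((245 * 2 ^ (-s)) * (N ^ 2) ^ s) *
        (ENNReal.ofReal ((1 + q.1 ^ 2) ^ (1 : ℝ) * ‖angularFT f q.1‖ ^ 2) *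
          ENNReal.ofReal ((1 + q.2 ^ 2) ^ (4 - s) * ‖angularFT f q.2‖ ^ 2)) := by
        gcongr with q
        rw [← ENNReal.ofReal_mul (by positivity), ← ENNReal.ofReal_mul (by positivity)]
        refine ENNReal.ofReal_le_ofReal ?_
        calc _ ≤ _ := mul_le_mul_of_nonneg_right (tangentWeight_le hs hb1 hN q)
              (by positivity)
          _ = _ := by ring
    _ = ENNReal.ofReal N * (ENNReal.ofReal ((245 * 2 ^ (-s)) * (N ^ 2) ^ s) *
        (I 1 * I (4 - s))) := by
        rw [lintegral_const_mul _ (by fun_prop), hprod]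
    _ = ENNReal.ofReal N * (ENNReal.ofReal ((245 * 2 ^ (-s)) * (N ^ 2) ^ s) *
        ENNReal.ofReal (I 1 * I (4 - s)).toReal) := by
        rw [ENNReal.ofReal_toReal (ENNReal.mul_ne_top (hfin _) (hfin _))]
    _ = _ := by
        rw [← ENNReal.ofReal_mul (by positivity), ← ENNReal.ofReal_mul (by positivity)]
        congr 1
        ring

theorem exists_le_Xnorm_wavePacket_sq {s b : ℝ} (hs : s ≤ 0) (hb : b ≤ 0)
    {f : ℝ → ℂ} (hf : ContDiff ℝ ∞ f) (hfc : HasCompactSupport f) (h0 : angularFT f 0 ≠ 0) :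
    ∃ c : ℝ, 0 < c ∧ ∀ N : ℝ, 1 ≤ N →
      ENNReal.ofReal (c * (N * (N ^ 2) ^ s)) ≤ Xnorm s b (wavePacket N f) ^ 2 := by
  have hF := continuous_angularFT hf hfc
  obtain ⟨m, hm0, hm⟩ := exists_between (show 0 < ‖angularFT f 0‖ ^ 2 by positivity)
  obtain ⟨ε, hε, hball⟩ := Metric.eventually_nhds_iff.1
    ((show Continuous fun σ => ‖angularFT f σ‖ ^ 2 by fun_prop).continuousAt.eventually
      (lt_mem_nhds hm))
  set δ := min 1 (ε / 2) with hδ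
  have hδ0 : 0 < δ := by positivity
  have hlow (σ : ℝ) (hσ : σ ∈ Set.Icc 0 δ) : m ≤ ‖angularFT f σ‖ ^ 2 := by
    refine (hball ?_).le
    rw [Real.dist_0_eq_abs, abs_of_nonneg hσ.1]
    linarith [hσ.2, min_le_right 1 (ε / 2)]
  have hsub : Set.Icc 0 δ ⊆ Set.Icc (0 : ℝ) 1 := Set.Icc_subset_Icc_right (min_le_left _ _)
  refine ⟨5 ^ s * 145 ^ b * (m * m) * (δ * δ), by positivity, fun N hN => ?_⟩
  have hN0 : 0 < N := by linarith
  rw [Xnorm_wavePacket_sq s b hN0 hf hfc]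
  calc ENNReal.ofReal (5 ^ s * 145 ^ b * (m * m) * (δ * δ) * (N * (N ^ 2) ^ s))
      = ENNReal.ofReal N * ∫⁻ _ in Set.Icc 0 δ ×ˢ Set.Icc 0 δ,
          ENNReal.ofReal (5 ^ s * 145 ^ b * (N ^ 2) ^ s * (m * m)) ∂(volume : Measure (ℝ × ℝ)) := by
        rw [setLIntegral_const, Measure.volume_eq_prod, Measure.prod_prod, Real.volume_Icc,
          sub_zero, ← ENNReal.ofReal_mul hδ0.le, ← ENNReal.ofReal_mul (by positivity),
          ← ENNReal.ofReal_mul hN0.le]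
        congr 1
        ring
    _ ≤ ENNReal.ofReal N * ∫⁻ q in Set.Icc 0 δ ×ˢ Set.Icc 0 δ, ENNReal.ofReal
          (tangentWeight s b N q * (‖angularFT f q.1‖ ^ 2 * ‖angularFT f q.2‖ ^ 2)) := by
        gcongr ENNReal.ofReal N * ?_
        refine setLIntegral_mono' (measurableSet_Icc.prod measurableSet_Icc) fun q hq => ?_
        refine ENNReal.ofReal_le_ofReal ?_
        exact mul_le_mul (le_tangentWeight hs hb hN (hsub hq.1) (hsub hq.2))
          (mul_le_mul (hlow _ hq.1) (hlow _ hq.2) hm0.le (by positivity)) (by positivity)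
          (tangentWeight_nonneg _ _ _ _)
    _ ≤ _ := by
        gcongr
        exact Measure.restrict_le_self

theorem wavePacket_mul_conj_mul (N : ℝ) (f : ℝ → ℝ) (p : ℝ × ℝ) :
    wavePacket N (fun t => (f t : ℂ)) p * (starRingEnd ℂ) (wavePacket N (fun t => (f t : ℂ)) p) *
      wavePacket N (fun t => (f t : ℂ)) p = wavePacket N (fun t => ((f t ^ 3 : ℝ) : ℂ)) p := by
  have h : Complex.exp (Complex.I * (p.2 * N - p.1 * N ^ 4)) *
      (starRingEnd ℂ) (Complex.exp (Complex.I * (p.2 * N - p.1 * N ^ 4))) = 1 := by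
    rw [← Complex.exp_conj, ← Complex.exp_add]
    simp
  simp only [wavePacket, map_mul, Complex.conj_ofReal]
  push_cast
  linear_combination (Complex.exp (Complex.I * (p.2 * N - p.1 * N ^ 4)) *
    (f p.1 ^ 3 * f ((p.2 - 4 * N ^ 3 * p.1) / N) ^ 3)) * h

theorem exists_wave_profile : ∃ f : ℝ → ℝ, ContDiff ℝ ∞ f ∧ HasCompactSupport f ∧
    angularFT (fun t => ((f t ^ 3 : ℝ) : ℂ)) 0 ≠ 0 := by
  let B : ContDiffBump (0 : ℝ) := ⟨1, 2, one_pos, one_lt_two⟩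
  refine ⟨B, B.contDiff, B.hasCompactSupport, ?_⟩
  have hpos : 0 < ∫ t, B t ^ 3 := by
    refine Continuous.integral_pos_of_hasCompactSupport_nonneg_nonzero (x := 0)
      (by have := B.continuous; fun_prop) ?_ (fun t => pow_nonneg B.nonneg 3) ?_
    · exact B.hasCompactSupport.comp_left (g := fun x : ℝ => x ^ 3) (by norm_num)
    · exact (pow_pos (B.pos_of_mem_ball (by simp [B])) 3).ne'
  have : angularFT (fun t => ((B t ^ 3 : ℝ) : ℂ)) 0 = ((∫ t, B t ^ 3 : ℝ) : ℂ) := by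
    simp only [angularFT, Complex.ofReal_zero, mul_zero, neg_zero, Complex.exp_zero, one_mul]
    exact integral_ofReal
  rw [this]
  exact_mod_cast hpos.ne'

theorem tendsto_mul_sq_rpow_atTop {s : ℝ} (hs : s < -(1/2)) :
    Filter.Tendsto (fun N : ℝ => N * (N ^ 2) ^ s) Filter.atTop (nhds 0) := by
  refine (tendsto_rpow_neg_atTop (y := -(1 + 2 * s)) (by linarith)).congr' ?_
  filter_upwards [Filter.eventually_gt_atTop 0] with N hN
  rw [neg_neg, Real.rpow_add hN, Real.rpow_one, Real.rpow_mul hN.le, Real.rpow_two]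

/-- Failure of the trilinear estimate for `s < -1/2`: for every constant `C > 0`
there are Schwartz functions `u₁, u₂, u₃` with
`‖u₁ ū₂ u₃‖_{X^{s,b-1}} > C ‖u₁‖_{X^{s,b}} ‖u₂‖_{X^{s,b}} ‖u₃‖_{X^{s,b}}`. -/
theorem stmt_10 (s b : ℝ) (hs : s < -(1/2)) (hb1 : 1/2 < b) (hb2 : b ≤ 1) :
    ∀ C > (0:ℝ), ∃ u₁ u₂ u₃ : SchwartzMap (ℝ × ℝ) ℂ,
      ENNReal.ofReal C * Xnorm s b (fun p => u₁ p) * Xnorm s b (fun p => u₂ p) *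
          Xnorm s b (fun p => u₃ p) <
        Xnorm s (b - 1) (fun p => u₁ p * (starRingEnd ℂ) (u₂ p) * u₃ p) := by
  intro C hC
  obtain ⟨f, hf, hfc, h0⟩ := exists_wave_profile
  have hg : ContDiff ℝ ∞ fun t => (f t : ℂ) := Complex.ofRealCLM.contDiff.comp hf
  have hgc : HasCompactSupport fun t => (f t : ℂ) :=
    hfc.comp_left (g := fun x : ℝ => (x : ℂ)) (by simp)
  have hg3 : ContDiff ℝ ∞ fun t => ((f t ^ 3 : ℝ) : ℂ) :=
    Complex.ofRealCLM.contDiff.comp (hf.pow 3)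
  have hgc3 : HasCompactSupport fun t => ((f t ^ 3 : ℝ) : ℂ) :=
    hfc.comp_left (g := fun x : ℝ => ((x ^ 3 : ℝ) : ℂ)) (by simp)
  obtain ⟨K, hK0, hK⟩ := exists_Xnorm_wavePacket_sq_le (s := s) (b := b) (by linarith) hb2 hg hgc
  obtain ⟨c, hc0, hc⟩ := exists_le_Xnorm_wavePacket_sq (s := s) (b := b - 1) (by linarith)
    (by linarith) hg3 hgc3 h0
  have hlim : Filter.Tendsto (fun N : ℝ => C ^ 2 * K ^ 3 * (N * (N ^ 2) ^ s) ^ 2) Filter.atTop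
      (nhds 0) := by
    simpa using ((tendsto_mul_sq_rpow_atTop hs).pow 2).const_mul (C ^ 2 * K ^ 3)
  obtain ⟨N, hNc, hN⟩ := ((hlim.eventually (gt_mem_nhds hc0)).and
    (Filter.eventually_ge_atTop 1)).exists
  have hN0 : 0 < N := by linarith
  let u : SchwartzMap (ℝ × ℝ) ℂ :=
    (hasCompactSupport_wavePacket hN0 hgc).toSchwartzMap (contDiff_wavePacket N hg)
  refine ⟨u, u, u, ?_⟩
  have hu : (fun p => u p) = wavePacket N fun t => (f t : ℂ) := rfl
  have hu3 : (fun p => u p * (starRingEnd ℂ) (u p) * u p) =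
      wavePacket N fun t => ((f t ^ 3 : ℝ) : ℂ) := funext (wavePacket_mul_conj_mul N f)
  rw [hu3, hu]
  set x := N * (N ^ 2) ^ s with hx
  have hx0 : 0 < x := by positivity
  set a := Xnorm s b (wavePacket N fun t => (f t : ℂ))
  refine lt_of_not_ge fun hle => (pow_le_pow_left' hle 2).not_gt ?_
  calc (ENNReal.ofReal C * a * a * a) ^ 2 = ENNReal.ofReal C ^ 2 * (a ^ 2) ^ 3 := by ring
    _ ≤ ENNReal.ofReal C ^ 2 * ENNReal.ofReal (K * x) ^ 3 := by
        gcongr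
        exact hK N hN
    _ = ENNReal.ofReal (C ^ 2 * (K * x) ^ 3) := by
        rw [← ENNReal.ofReal_pow hC.le, ← ENNReal.ofReal_pow (by positivity),
          ← ENNReal.ofReal_mul (by positivity)]
    _ < ENNReal.ofReal (c * x) := by
        refine (ENNReal.ofReal_lt_ofReal_iff (by positivity)).2 ?_
        calc C ^ 2 * (K * x) ^ 3 = C ^ 2 * K ^ 3 * x ^ 2 * x := by ring
          _ < c * x := by gcongr
    _ ≤ _ := hc N hN
end

section
/- There exists a constant C > 0, depending only on C₀, such that the following holds for every N ≥ 1 and every multiplier m as in the context: for all ξ₁, ξ₂, ξ₃, ξ₄ ∈ ℝ with ξ₁ + ξ₂ + ξ₃ + ξ₄ = 0 and ξ₁⁴ − ξ₂⁴ + ξ₃⁴ − ξ₄⁴ ≠ 0, one has |m²(ξ₁) − m²(ξ₂) + m²(ξ₃) − m²(ξ₄)| / |ξ₁⁴ − ξ₂⁴ + ξ₃⁴ − ξ₄⁴| ≤ C · m²(ξ_min) / ((N + |ξ₁|)(N + |ξ₂|)(N + |ξ₃|)(N + |ξ₄|)), where ξ_min is a value among ξ₁, ξ₂, ξ₃, ξ₄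 of minimal absolute value. -/
/-- `m` is the `I`-method multiplier at level `N` (with `s = -1/2`), with derivative
bounds of constant `C₀`: `m : ℝ → [0,1]` is smooth, even, nonincreasing in `|ξ|`,
`m(ξ) = 1` for `|ξ| ≤ N`, `m(ξ) = (|ξ|/N)^{-1/2}` for `|ξ| ≥ 2N`, and
`|(m²)'(ξ)| ≤ C₀ m²(ξ)/|ξ|`, `|(m²)''(ξ)| ≤ C₀ m²(ξ)/ξ²` for `ξ ≠ 0`. -/
def IsIMultiplier (N C₀ : ℝ) (m : ℝ → ℝ) : Prop :=
  ContDiff ℝ (⊤ : ℕ∞) m ∧ (∀ ξ, m (-ξ) = m ξ) ∧ (∀ ξ, m ξ ∈ Set.Icc (0:ℝ) 1) ∧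
  (∀ a b : ℝ, 0 ≤ a → a ≤ b → m b ≤ m a) ∧
  (∀ ξ : ℝ, |ξ| ≤ N → m ξ = 1) ∧
  (∀ ξ : ℝ, 2 * N ≤ |ξ| → m ξ = (|ξ| / N) ^ (-(1/2) : ℝ)) ∧
  (∀ ξ : ℝ, ξ ≠ 0 → |deriv (fun x => (m x)^2) ξ| ≤ C₀ * (m ξ)^2 / |ξ|) ∧
  (∀ ξ : ℝ, ξ ≠ 0 → |deriv (deriv (fun x => (m x)^2)) ξ| ≤ C₀ * (m ξ)^2 / ξ^2)

/-- Mean value inequality on a closed interval `[p - r, p + r]`. -/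
lemma abs_sub_le_of_abs_deriv_le {g : ℝ → ℝ} (hg : Differentiable ℝ g) {p r K u v : ℝ}
    (hK : ∀ y, |y - p| ≤ r → |deriv g y| ≤ K) (hu : |u - p| ≤ r) (hv : |v - p| ≤ r) :
    |g u - g v| ≤ K * |u - v| := by
  have h := Convex.norm_image_sub_le_of_norm_deriv_le (f := g) (C := K)
    (s := Metric.closedBall p r) (x := v) (y := u) (fun x _ => hg x)
    (fun y hy => hK y (by simpa [Real.dist_eq] using hy)) (convex_closedBall p r)
    (by simpa [Real.dist_eq] using hv) (by simpa [Real.dist_eq] using hu)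
  simpa using h

lemma abs_secondDiff_mul_le {f : ℝ → ℝ} {N K L p a b : ℝ} (hf : Differentiable ℝ f)
    (hf' : Differentiable ℝ (deriv f)) (hN : 0 < N) (hK : 0 ≤ K)
    (h0 : ∀ y, |f y| ≤ 3 * N / (N + |y|))
    (h1 : ∀ y, |deriv f y| ≤ K * N / (N + |y|) ^ 2)
    (h2 : ∀ y, |deriv (deriv f) y| ≤ K * N / (N + |y|) ^ 3)
    (hba : |b| ≤ |a|) (hL : 0 < L) (hp : L ≤ N + |p|) (hpa : L ≤ N + |p - a|)
    (hpb : L ≤ N + |p - b|) (hpab : L ≤ N + |p - a - b|) :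
    |f p - f (p - a) - f (p - b) + f (p - a - b)| * (L ^ 2 * (L + 2 * |a|)) ≤
      (96 + 48 * K) * (|a| * |b| * N) := by
  have hKN : 0 ≤ K * N := by positivity
  have ha := abs_nonneg a
  have hb := abs_nonneg b
  have hpos : 0 ≤ |a| * |b| * N := by positivity
  have far : ∀ q r y, L ≤ N + |q| → r ≤ L / 2 → |y - q| ≤ r → L / 2 ≤ N + |y| := by
    intro q r y hq hr hy
    have : |q| ≤ |y| + |y - q| := by
      have := abs_sub_abs_le_abs_sub q y
      rw [abs_sub_comm] at this
      linarith
    linarith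
  have d1 : ∀ y, L / 2 ≤ N + |y| → |deriv f y| ≤ K * N / (L / 2) ^ 2 := fun y hy =>
    (h1 y).trans (by gcongr)
  have d2 : ∀ y, L / 2 ≤ N + |y| → |deriv (deriv f) y| ≤ K * N / (L / 2) ^ 3 := fun y hy =>
    (h2 y).trans (by gcongr)
  rcases le_or_gt |a| (L / 4) with hA | hA
  · have hφ : Differentiable ℝ fun t => f t - f (t - b) :=
      hf.sub (hf.comp (differentiable_id.sub_const b))
    have hφ' : ∀ y, deriv (fun t => f t - f (t - b)) y = deriv f y - deriv f (y - b) := by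
      intro y
      have e : HasDerivAt (fun t => f (t - b)) (deriv f (y - b)) y :=
        (hf (y - b)).hasDerivAt.comp_sub_const y b
      exact ((hf y).hasDerivAt.sub e).deriv
    have key := abs_sub_le_of_abs_deriv_le hφ (p := p) (r := |a|) (u := p) (v := p - a)
      (K := K * N / (L / 2) ^ 3 * |b|) (by
        intro y hy
        rw [hφ']
        have := abs_sub_le_of_abs_deriv_le hf' (p := p) (r := |a| + |b|) (u := y) (v := y - b)
          (K := K * N / (L / 2) ^ 3)
          (fun z hz => d2 z (far p (|a| + |b|) z hp (by linarith) hz)) (by linarith)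
          (by
            have := abs_sub (y - p) b
            rw [show y - b - p = y - p - b by ring]
            linarith)
        simpa using this) (by simp) (by simp)
    have e : f p - f (p - a) - f (p - b) + f (p - a - b) =
        f p - f (p - b) - (f (p - a) - f (p - a - b)) := by ring
    rw [e]
    simp only [sub_sub_cancel] at key
    calc _ ≤ K * N / (L / 2) ^ 3 * |b| * |a| * (L ^ 2 * (3 / 2 * L)) := by
          gcongr
          linarith
      _ = 12 * K * (|a| * |b| * N) := by field_simp; ring
      _ ≤ _ := by nlinarith
  rcases le_or_gt |b| (L / 2) with hB | hB
  · have k1 := abs_sub_le_of_abs_deriv_le hf (p := p) (r := |b|) (u := p) (v := p - b)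
      (fun z hz => d1 z (far p |b| z hp hB hz)) (by simp) (by simp)
    have k2 := abs_sub_le_of_abs_deriv_le hf (p := p - a) (r := |b|) (u := p - a)
      (v := p - a - b) (fun z hz => d1 z (far (p - a) |b| z hpa hB hz)) (by simp) (by simp)
    simp only [sub_sub_cancel] at k1 k2
    have e : f p - f (p - a) - f (p - b) + f (p - a - b) =
        f p - f (p - b) - (f (p - a) - f (p - a - b)) := by ring
    have k3 := abs_sub (f p - f (p - b)) (f (p - a) - f (p - a - b))
    rw [e]
    calc _ ≤ (2 * (K * N / (L / 2) ^ 2 * |b|)) * (L ^ 2 * (6 * |a|)) := by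
          gcongr
          · linarith
          · linarith
      _ = 48 * K * (|a| * |b| * N) := by field_simp; ring
      _ ≤ _ := by nlinarith
  · have d0 : ∀ y, L ≤ N + |y| → |f y| ≤ 3 * N / L := fun y hy =>
      (h0 y).trans (by gcongr)
    have q1 := abs_le.1 (d0 _ hp)
    have q2 := abs_le.1 (d0 _ hpa)
    have q3 := abs_le.1 (d0 _ hpb)
    have q4 := abs_le.1 (d0 _ hpab)
    have k : |f p - f (p - a) - f (p - b) + f (p - a - b)| ≤ 4 * (3 * N / L) := by
      rw [abs_le]; constructor <;> linarith [q1.1, q1.2, q2.1, q2.2, q3.1, q3.2, q4.1, q4.2]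
    calc _ ≤ 4 * (3 * N / L) * (L ^ 2 * (4 * |a|)) := by
          gcongr
          linarith
      _ = 48 * N * |a| * L := by field_simp; ring
      _ ≤ 48 * N * |a| * (2 * |b|) := by
          gcongr
          linarith
      _ = 96 * (|a| * |b| * N) := by ring
      _ ≤ _ := by nlinarith [mul_nonneg hK hpos]

namespace IsIMultiplier

variable {N C₀ : ℝ} {m : ℝ → ℝ}

lemma sq_even (hm : IsIMultiplier N C₀ m) (ξ : ℝ) : m (-ξ) ^ 2 = m ξ ^ 2 := by
  rw [hm.2.1]

lemma apply_abs (hm : IsIMultiplier N C₀ m) (ξ : ℝ) : m |ξ| = m ξ := by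
  rcases abs_choice ξ with h | h <;> rw [h]
  exact hm.2.1 ξ

lemma sq_of_two_mul_le (hm : IsIMultiplier N C₀ m) (hN : 0 < N) {ξ : ℝ} (h : 2 * N ≤ |ξ|) :
    m ξ ^ 2 = N / |ξ| := by
  have hpos : 0 < |ξ| := by linarith
  rw [hm.2.2.2.2.2.1 ξ h, ← Real.rpow_natCast, ← Real.rpow_mul (by positivity)]
  norm_num
  rw [Real.rpow_neg_one, inv_div]

lemma le_sq (hm : IsIMultiplier N C₀ m) (hN : 0 < N) (ξ : ℝ) : N / (N + |ξ|) ≤ m ξ ^ 2 := by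
  have habs := abs_nonneg ξ
  rcases le_total |ξ| N with h | h
  · rw [hm.2.2.2.2.1 ξ h, div_le_iff₀ (by positivity)]
    linarith
  rcases le_total |ξ| (2 * N) with h' | h'
  · have h2 : m (2 * N) ^ 2 = 1 / 2 := by
      have e : |2 * N| = 2 * N := abs_of_pos (by positivity)
      rw [hm.sq_of_two_mul_le hN e.ge, e]
      field_simp
    have hmono := hm.2.2.2.1 |ξ| (2 * N) habs h'
    rw [hm.apply_abs] at hmono
    have : m (2 * N) ^ 2 ≤ m ξ ^ 2 := pow_le_pow_left₀ (hm.2.2.1 _).1 hmono 2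
    refine le_trans ?_ (h2 ▸ this)
    rw [div_le_div_iff₀ (by positivity) (by positivity)]
    linarith
  · rw [hm.sq_of_two_mul_le hN h']
    gcongr
    · linarith
    · linarith

lemma sq_le (hm : IsIMultiplier N C₀ m) (hN : 0 < N) (ξ : ℝ) :
    m ξ ^ 2 ≤ 3 * N / (N + |ξ|) := by
  have habs := abs_nonneg ξ
  rcases le_total |ξ| (2 * N) with h | h
  · refine (pow_le_one₀ (hm.2.2.1 ξ).1 (hm.2.2.1 ξ).2).trans ?_
    rw [le_div_iff₀ (by positivity)]
    linarith
  · rw [hm.sq_of_two_mul_le hN h, div_le_div_iff₀ (by linarith) (by positivity)]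
    nlinarith

lemma sq_eventuallyEq_one (hm : IsIMultiplier N C₀ m) {ξ : ℝ} (h : |ξ| < N) :
    (fun x => m x ^ 2) =ᶠ[nhds ξ] fun _ => 1 := by
  filter_upwards [(isOpen_lt continuous_abs continuous_const).mem_nhds h] with x hx
  rw [hm.2.2.2.2.1 x (le_of_lt hx), one_pow]

lemma abs_deriv_sq_le (hm : IsIMultiplier N C₀ m) (hN : 0 < N) (hC₀ : 0 < C₀) (ξ : ℝ) :
    |deriv (fun x => m x ^ 2) ξ| ≤ 12 * C₀ * N / (N + |ξ|) ^ 2 := by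
  rcases lt_or_ge |ξ| N with h | h
  · rw [(hm.sq_eventuallyEq_one h).deriv_eq]
    simp only [deriv_const, abs_zero]
    positivity
  · have hpos : 0 < |ξ| := by linarith
    refine (hm.2.2.2.2.2.2.1 ξ (abs_pos.1 hpos)).trans ?_
    calc C₀ * m ξ ^ 2 / |ξ| ≤ C₀ * (3 * N / (N + |ξ|)) / ((N + |ξ|) / 2) := by
          gcongr
          · exact hm.sq_le hN ξ
          · linarith
      _ = 6 * C₀ * N / (N + |ξ|) ^ 2 := by field_simp; ring
      _ ≤ _ := by gcongr; norm_num

lemma abs_deriv_deriv_sq_le (hm : IsIMultiplier N C₀ m) (hN : 0 < N) (hC₀ : 0 < C₀) (ξ : ℝ) :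
    |deriv (deriv fun x => m x ^ 2) ξ| ≤ 12 * C₀ * N / (N + |ξ|) ^ 3 := by
  rcases lt_or_ge |ξ| N with h | h
  · rw [(hm.sq_eventuallyEq_one h).deriv.deriv_eq]
    simp only [deriv_const', deriv_const, abs_zero]
    positivity
  · have hpos : 0 < |ξ| := by linarith
    refine (hm.2.2.2.2.2.2.2 ξ (abs_pos.1 hpos)).trans ?_
    rw [← sq_abs ξ]
    calc C₀ * m ξ ^ 2 / |ξ| ^ 2 ≤ C₀ * (3 * N / (N + |ξ|)) / ((N + |ξ|) / 2) ^ 2 := by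
          gcongr
          · exact hm.sq_le hN ξ
          · linarith
      _ = _ := by field_simp; ring

/-- The second-difference bound for `m²`, in terms of `ξ₁ + ξ₂` and `ξ₁ + ξ₄`. -/
lemma abs_alternating_sum_mul_le (hm : IsIMultiplier N C₀ m) (hN : 0 < N) (hC₀ : 0 < C₀)
    {L ξ₁ ξ₂ ξ₃ ξ₄ : ℝ} (hsum : ξ₁ + ξ₂ + ξ₃ + ξ₄ = 0) (hL : 0 < L)
    (h₁ : L ≤ N + |ξ₁|) (h₂ : L ≤ N + |ξ₂|) (h₃ : L ≤ N + |ξ₃|) (h₄ : L ≤ N + |ξ₄|)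
    (hab : |ξ₁ + ξ₄| ≤ |ξ₁ + ξ₂|) :
    |m ξ₁ ^ 2 - m ξ₂ ^ 2 + m ξ₃ ^ 2 - m ξ₄ ^ 2| * (L ^ 2 * (L + 2 * |ξ₁ + ξ₂|)) ≤
      (96 + 48 * (12 * C₀)) * (|ξ₁ + ξ₂| * |ξ₁ + ξ₄| * N) := by
  have hc : ContDiff ℝ 2 fun x => m x ^ 2 :=
    (hm.1.pow 2).of_le (WithTop.coe_le_coe.2 (le_top : (2 : ℕ∞) ≤ ⊤))
  have e₂ : ξ₁ - (ξ₁ + ξ₂) = -ξ₂ := by ring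
  have e₄ : ξ₁ - (ξ₁ + ξ₄) = -ξ₄ := by ring
  have e₃ : ξ₁ - (ξ₁ + ξ₂) - (ξ₁ + ξ₄) = ξ₃ := by linarith
  have key := abs_secondDiff_mul_le (f := fun x => m x ^ 2) (K := 12 * C₀) (p := ξ₁)
    (a := ξ₁ + ξ₂) (b := ξ₁ + ξ₄) (hc.differentiable (by norm_num))
    (hc.differentiable_deriv_two) hN (by positivity)
    (fun y => by rw [abs_of_nonneg (sq_nonneg _)]; exact hm.sq_le hN y)
    (hm.abs_deriv_sq_le hN hC₀) (hm.abs_deriv_deriv_sq_le hN hC₀) hab hL h₁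
    (by rwa [e₂, abs_neg]) (by rwa [e₄, abs_neg]) (by rwa [e₃])
  beta_reduce at key
  rw [e₃, e₂, e₄, hm.sq_even, hm.sq_even] at key
  rwa [show m ξ₁ ^ 2 - m ξ₂ ^ 2 + m ξ₃ ^ 2 - m ξ₄ ^ 2 =
    m ξ₁ ^ 2 - m ξ₂ ^ 2 - m ξ₄ ^ 2 + m ξ₃ ^ 2 by ring]

end IsIMultiplier

lemma prod_le_of_sq_le {L R T x₁ x₂ x₃ x₄ : ℝ} (hL : 0 ≤ L) (h₁ : L ≤ x₁) (h₂ : L ≤ x₂)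
    (h₃ : L ≤ x₃) (h₄ : L ≤ x₄) (hmin : L = x₁ ∨ L = x₂ ∨ L = x₃ ∨ L = x₄)
    (k₁ : x₁ ≤ R) (k₂ : x₂ ≤ R) (s₂ : x₂ ^ 2 ≤ T)
    (s₃ : x₃ ^ 2 ≤ T) (s₄ : x₄ ^ 2 ≤ T) : x₁ * x₂ * x₃ * x₄ ≤ L * R * T := by
  have amgm : ∀ {x y : ℝ}, x ^ 2 ≤ T → y ^ 2 ≤ T → x * y ≤ T := fun {x y} hx hy => by
    nlinarith [sq_nonneg (x - y)]
  have aux : ∀ {x y z : ℝ}, 0 ≤ x → x ≤ R → 0 ≤ y → 0 ≤ z → y ^ 2 ≤ T → z ^ 2 ≤ T →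
      L * x * (y * z) ≤ L * R * T := by
    intro x y z hx hxR hy hz hyT hzT
    have hR := hx.trans hxR
    gcongr
    exact amgm hyT hzT
  have p₁ := hL.trans h₁
  have p₂ := hL.trans h₂
  have p₃ := hL.trans h₃
  have p₄ := hL.trans h₄
  rcases hmin with h | h | h | h
  · have := aux p₂ k₂ p₃ p₄ s₃ s₄
    rw [h] at this ⊢; linarith
  · have := aux p₁ k₁ p₃ p₄ s₃ s₄
    rw [h] at this ⊢; linarith
  · have := aux p₁ k₁ p₂ p₄ s₂ s₄
    rw [h] at this ⊢; linarith
  · have := aux p₁ k₁ p₂ p₃ s₂ s₃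
    rw [h] at this ⊢; linarith

lemma quartic_alternating_sum_eq {ξ₁ ξ₂ ξ₃ ξ₄ : ℝ} (hsum : ξ₁ + ξ₂ + ξ₃ + ξ₄ = 0) :
    ξ₁ ^ 4 - ξ₂ ^ 4 + ξ₃ ^ 4 - ξ₄ ^ 4 = (ξ₁ + ξ₂) * (ξ₁ + ξ₄) *
      (ξ₁ ^ 2 + ξ₂ ^ 2 + ξ₃ ^ 2 + ξ₄ ^ 2 + 2 * (ξ₁ + ξ₃) ^ 2) := by
  obtain rfl : ξ₃ = -ξ₁ - ξ₂ - ξ₄ := by linarith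
  ring

lemma IsIMultiplier.abs_alternating_sum_div_le {N C₀ : ℝ} {m : ℝ → ℝ}
    (hm : IsIMultiplier N C₀ m) (hN : 0 < N) (hC₀ : 0 < C₀) {ξ₁ ξ₂ ξ₃ ξ₄ : ℝ}
    (hsum : ξ₁ + ξ₂ + ξ₃ + ξ₄ = 0) (hne : ξ₁ ^ 4 - ξ₂ ^ 4 + ξ₃ ^ 4 - ξ₄ ^ 4 ≠ 0)
    (hab : |ξ₁ + ξ₄| ≤ |ξ₁ + ξ₂|) :
    |m ξ₁ ^ 2 - m ξ₂ ^ 2 + m ξ₃ ^ 2 - m ξ₄ ^ 2| / |ξ₁ ^ 4 - ξ₂ ^ 4 + ξ₃ ^ 4 - ξ₄ ^ 4| ≤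
      (4 * (96 + 48 * (12 * C₀))) * m (min (min |ξ₁| |ξ₂|) (min |ξ₃| |ξ₄|)) ^ 2 /
        ((N + |ξ₁|) * (N + |ξ₂|) * (N + |ξ₃|) * (N + |ξ₄|)) := by
  set s := min (min |ξ₁| |ξ₂|) (min |ξ₃| |ξ₄|) with hs
  have n₁ := abs_nonneg ξ₁
  have n₂ := abs_nonneg ξ₂
  have n₃ := abs_nonneg ξ₃
  have n₄ := abs_nonneg ξ₄
  have s₁ : s ≤ |ξ₁| := (min_le_left _ _).trans (min_le_left _ _)
  have s₂ : s ≤ |ξ₂| := (min_le_left _ _).trans (min_le_right _ _)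
  have s₃ : s ≤ |ξ₃| := (min_le_right _ _).trans (min_le_left _ _)
  have s₄ : s ≤ |ξ₄| := (min_le_right _ _).trans (min_le_right _ _)
  have s₀ : 0 ≤ s := le_min (le_min n₁ n₂) (le_min n₃ n₄)
  have hmin : s = |ξ₁| ∨ s = |ξ₂| ∨ s = |ξ₃| ∨ s = |ξ₄| := by
    rcases min_choice (min |ξ₁| |ξ₂|) (min |ξ₃| |ξ₄|) with h | h <;> rw [← hs] at h
    · rcases min_choice |ξ₁| |ξ₂| with h' | h' <;> rw [h'] at h <;> simp [h]
    · rcases min_choice |ξ₃| |ξ₄| with h' | h' <;> rw [h'] at h <;> simp [h]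
  rw [div_le_div_iff₀ (abs_pos.2 hne) (by positivity)]
  by_cases hlow : |ξ₁| ≤ N ∧ |ξ₂| ≤ N ∧ |ξ₃| ≤ N ∧ |ξ₄| ≤ N
  · have one := hm.2.2.2.2.1
    rw [one _ hlow.1, one _ hlow.2.1, one _ hlow.2.2.1, one _ hlow.2.2.2]
    norm_num
    positivity
  set T := ξ₁ ^ 2 + ξ₂ ^ 2 + ξ₃ ^ 2 + ξ₄ ^ 2 with hT
  have hNT : N ^ 2 ≤ T := by
    by_contra! hcon
    apply hlow
    refine ⟨?_, ?_, ?_, ?_⟩ <;> refine abs_le_of_sq_le_sq ?_ hN.le <;>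
      nlinarith [sq_nonneg ξ₁, sq_nonneg ξ₂, sq_nonneg ξ₃, sq_nonneg ξ₄]
  have hsq : ∀ ξ : ℝ, ξ ^ 2 ≤ T → (N + |ξ|) ^ 2 ≤ 4 * T := by
    intro ξ h
    nlinarith [sq_abs ξ, sq_nonneg (N - |ξ|)]
  have hR : ∀ ξ : ℝ, (ξ = ξ₁ ∨ ξ = ξ₂) → N + |ξ| ≤ N + s + 2 * |ξ₁ + ξ₂| := by
    have a₁₂ : abs ξ₁ ≤ |ξ₂| + |ξ₁ + ξ₂| := by
      have := abs_sub (ξ₁ + ξ₂) ξ₂; rw [add_sub_cancel_right] at this; linarith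
    have a₂₁ : abs ξ₂ ≤ |ξ₁| + |ξ₁ + ξ₂| := by
      have := abs_sub (ξ₁ + ξ₂) ξ₁; rw [add_sub_cancel_left] at this; linarith
    have a₁₄ : abs ξ₁ ≤ |ξ₄| + |ξ₁ + ξ₄| := by
      have := abs_sub (ξ₁ + ξ₄) ξ₄; rw [add_sub_cancel_right] at this; linarith
    have a₂₃ : abs ξ₂ ≤ |ξ₃| + |ξ₁ + ξ₄| := by
      have := abs_sub (-ξ₃) (ξ₁ + ξ₄)
      rw [show -ξ₃ - (ξ₁ + ξ₄) = ξ₂ by linarith, abs_neg] at this; linarith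
    rintro ξ (hξ | hξ) <;> rw [hξ] <;> rcases hmin with h | h | h | h <;> rw [h] <;>
      linarith [abs_nonneg (ξ₁ + ξ₂)]
  have hprod := prod_le_of_sq_le (L := N + s) (R := N + s + 2 * |ξ₁ + ξ₂|) (T := 4 * T)
    (x₁ := N + |ξ₁|) (x₂ := N + |ξ₂|) (x₃ := N + |ξ₃|) (x₄ := N + |ξ₄|) (by positivity)
    (by linarith) (by linarith) (by linarith) (by linarith)
    (by simpa only [add_right_inj] using hmin) (hR _ (.inl rfl)) (hR _ (.inr rfl))
    (hsq _ (by rw [hT]; nlinarith [sq_nonneg ξ₁, sq_nonneg ξ₃, sq_nonneg ξ₄]))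
    (hsq _ (by rw [hT]; nlinarith [sq_nonneg ξ₂, sq_nonneg ξ₁, sq_nonneg ξ₄]))
    (hsq _ (by rw [hT]; nlinarith [sq_nonneg ξ₂, sq_nonneg ξ₃, sq_nonneg ξ₁]))
  have key := hm.abs_alternating_sum_mul_le hN hC₀ hsum (L := N + s) (by positivity)
    (by linarith) (by linarith) (by linarith) (by linarith) hab
  have hlow_s := hm.le_sq hN s
  rw [abs_of_nonneg s₀] at hlow_s
  have hquartic : |ξ₁ + ξ₂| * |ξ₁ + ξ₄| * T ≤ |ξ₁ ^ 4 - ξ₂ ^ 4 + ξ₃ ^ 4 - ξ₄ ^ 4| := by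
    rw [quartic_alternating_sum_eq hsum, abs_mul, abs_mul]
    gcongr
    refine le_trans ?_ (le_abs_self _)
    rw [hT]
    linarith [sq_nonneg (ξ₁ + ξ₃)]
  have hT0 : 0 ≤ T := (sq_nonneg N).trans hNT
  set D := |m ξ₁ ^ 2 - m ξ₂ ^ 2 + m ξ₃ ^ 2 - m ξ₄ ^ 2|
  have hLpos : 0 < N + s := by positivity
  calc D * ((N + |ξ₁|) * (N + |ξ₂|) * (N + |ξ₃|) * (N + |ξ₄|))
      ≤ D * ((N + s) * (N + s + 2 * |ξ₁ + ξ₂|) * (4 * T)) := by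
        gcongr
    _ = D * ((N + s) ^ 2 * (N + s + 2 * |ξ₁ + ξ₂|)) * (4 * T) / (N + s) := by
        field_simp
    _ ≤ (96 + 48 * (12 * C₀)) * (|ξ₁ + ξ₂| * |ξ₁ + ξ₄| * N) * (4 * T) / (N + s) := by
        gcongr
    _ = 4 * (96 + 48 * (12 * C₀)) * (N / (N + s)) * (|ξ₁ + ξ₂| * |ξ₁ + ξ₄| * T) := by
        ring
    _ ≤ _ := by gcongr

/-- Pointwise multiplier bound for `σ₄ = M₄/α₄`:
`|m²(ξ₁)−m²(ξ₂)+m²(ξ₃)−m²(ξ₄)| / |ξ₁⁴−ξ₂⁴+ξ₃⁴−ξ₄⁴|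
  ≤ C m²(ξ_min) / ((N+|ξ₁|)(N+|ξ₂|)(N+|ξ₃|)(N+|ξ₄|))`
on the hyperplane `ξ₁+ξ₂+ξ₃+ξ₄ = 0`, where `|ξ_min|` is the minimal absolute value
(the statement is phrased with `m` evaluated at this minimum, which is legitimate
since `m` is even). -/
theorem stmt_11 (C₀ : ℝ) (hC₀ : 0 < C₀) :
    ∃ C > (0:ℝ), ∀ N : ℝ, 1 ≤ N → ∀ m : ℝ → ℝ, IsIMultiplier N C₀ m →
      ∀ ξ₁ ξ₂ ξ₃ ξ₄ : ℝ, ξ₁ + ξ₂ + ξ₃ + ξ₄ = 0 →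
        ξ₁^4 - ξ₂^4 + ξ₃^4 - ξ₄^4 ≠ 0 →
        |(m ξ₁)^2 - (m ξ₂)^2 + (m ξ₃)^2 - (m ξ₄)^2| / |ξ₁^4 - ξ₂^4 + ξ₃^4 - ξ₄^4| ≤
          C * (m (min (min |ξ₁| |ξ₂|) (min |ξ₃| |ξ₄|)))^2 /
            ((N + |ξ₁|) * (N + |ξ₂|) * (N + |ξ₃|) * (N + |ξ₄|)) := by
  refine ⟨4 * (96 + 48 * (12 * C₀)), by positivity, ?_⟩
  intro N hN m hm ξ₁ ξ₂ ξ₃ ξ₄ hsum hne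
  have hN' : 0 < N := by linarith
  rcases le_total |ξ₁ + ξ₄| |ξ₁ + ξ₂| with h | h
  · exact hm.abs_alternating_sum_div_le hN' hC₀ hsum hne h
  · have key := hm.abs_alternating_sum_div_le hN' hC₀ (ξ₁ := ξ₁) (ξ₂ := ξ₄)
      (ξ₃ := ξ₃) (ξ₄ := ξ₂)
      (by linarith) (fun h' => hne (by linarith)) h
    have hmin : min (min |ξ₁| |ξ₄|) (min |ξ₃| |ξ₂|) =
        min (min |ξ₁| |ξ₂|) (min |ξ₃| |ξ₄|) := by
      ac_rfl
    rw [hmin] at key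
    convert key using 2
    · congr 1; ring
    · congr 1; ring
    · ring
end

section
/- There exists a constant C > 0, depending only on C₀, such that for every N ≥ 1, every multiplier m as in the context, and every Schwartz function u on ℝ, |Λ₄(σ₄; u)| ≤ C ‖Iu‖_{L²(ℝ)}⁴, where Λ₄(σ₄; u) = ∫_{ℝ³} σ₄(ξ₁, ξ₂, ξ₃, −ξ₁−ξ₂−ξ₃) û(ξ₁) ŵ(ξ₂) û(ξ₃) ŵ(−ξ₁−ξ₂−ξ₃) dξ₁ dξ₂ dξ₃ and ŵ(ξ) = conj(û(−ξ)) is the Fourier transform of the complex conjugate of u. -/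
open MeasureTheory Complex

/-- The correction-term multiplier `σ₄`. -/
noncomputable def sigma4 (m : ℝ → ℝ) (a b c d : ℝ) : ℝ :=
  if a^4 - b^4 + c^4 - d^4 = 0 then 0
  else ((m a)^2 - (m b)^2 + (m c)^2 - (m d)^2) / (a^4 - b^4 + c^4 - d^4)

/-- The Fourier transform `û(ξ) = ∫ e^{-ixξ} u(x) dx`. -/
noncomputable def fourierInt (u : ℝ → ℂ) (ξ : ℝ) : ℂ :=
  ∫ x : ℝ, Complex.exp (-(Complex.I * x * ξ)) * u x

/-- The operator `I`, `(Iu)^(ξ) = m(ξ) û(ξ)`, realized in physical space. -/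
noncomputable def Iop (m : ℝ → ℝ) (u : ℝ → ℂ) (x : ℝ) : ℂ :=
  (2 * Real.pi)⁻¹ * ∫ ξ : ℝ, Complex.exp (Complex.I * x * ξ) * (m ξ : ℂ) * fourierInt u ξ

/-- A double mean value inequality: the alternating sum of `f` over a parallelogram is controlled by
its side lengths and a bound on the second derivative. -/
theorem abs_parallelogram_diff_le {f : ℝ → ℝ} (hf : ContDiff ℝ 2 f) {K x r a b c d : ℝ}
    (hK : ∀ ξ ∈ Set.Icc (x - r) (x + r), |deriv (deriv f) ξ| ≤ K)
    (habcd : a + c = b + d)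
    (ha : a ∈ Set.Icc (x - r) (x + r)) (hb : b ∈ Set.Icc (x - r) (x + r))
    (hc : c ∈ Set.Icc (x - r) (x + r)) (hd : d ∈ Set.Icc (x - r) (x + r)) :
    |f a - f b + f c - f d| ≤ K * |a - b| * |a - d| := by
  have hf0 : Differentiable ℝ f := hf.differentiable (by norm_num)
  have hf1 : Differentiable ℝ (deriv f) :=
    ((contDiff_succ_iff_deriv (n := 1)).1 hf).2.2.differentiable (by norm_num)
  have key : ∀ t ∈ segment ℝ d a, ‖deriv (fun t => f t - f (t - (a - b))) t‖ ≤ K * |a - b| := by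
    intro t ht
    have hd1 : deriv (fun t => f t - f (t - (a - b))) t = deriv f t - deriv f (t - (a - b)) := by
      rw [deriv_fun_sub (hf0 t) (by fun_prop), deriv_comp_sub_const]
    have ht1 : t ∈ Set.Icc (x - r) (x + r) := (convex_Icc (𝕜 := ℝ) _ _).segment_subset hd ha ht
    have ht2 : t - (a - b) ∈ Set.Icc (x - r) (x + r) := by
      apply (convex_Icc (𝕜 := ℝ) _ _).segment_subset hc hb
      rw [segment_eq_uIcc, Set.mem_uIcc] at ht ⊢
      rcases ht with h | h
      · left; constructor <;> linarith [h.1, h.2]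
      · right; constructor <;> linarith [h.1, h.2]
    have := (convex_Icc (x - r) (x + r)).norm_image_sub_le_of_norm_deriv_le
      (f := deriv f) (fun ξ _ => hf1 ξ) hK ht2 ht1
    rw [hd1]
    simpa using this
  have := (convex_segment d a).norm_image_sub_le_of_norm_deriv_le
    (f := fun t => f t - f (t - (a - b)))
    (fun ξ _ => by fun_prop) key (left_mem_segment ℝ d a) (right_mem_segment ℝ d a)
  have e1 : a - (a - b) = b := by ring
  have e2 : d - (a - b) = c := by linarith
  simp only [e1, e2, Real.norm_eq_abs] at this
  convert this using 2
  ring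

theorem IsIMultiplier.abs_eq {N C₀ : ℝ} {m : ℝ → ℝ} (hm : IsIMultiplier N C₀ m) (ξ : ℝ) :
    m |ξ| = m ξ := by
  rcases abs_choice ξ with h | h <;> rw [h]
  exact hm.2.1 ξ

theorem IsIMultiplier.nonneg {N C₀ : ℝ} {m : ℝ → ℝ} (hm : IsIMultiplier N C₀ m) (ξ : ℝ) :
    0 ≤ m ξ := (hm.2.2.1 ξ).1

theorem IsIMultiplier.le_one {N C₀ : ℝ} {m : ℝ → ℝ} (hm : IsIMultiplier N C₀ m) (ξ : ℝ) :
    m ξ ≤ 1 := (hm.2.2.1 ξ).2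

theorem IsIMultiplier.sq_le_one {N C₀ : ℝ} {m : ℝ → ℝ} (hm : IsIMultiplier N C₀ m) (ξ : ℝ) :
    m ξ ^ 2 ≤ 1 := pow_le_one₀ (hm.nonneg ξ) (hm.le_one ξ)

theorem IsIMultiplier.sq_eq {N C₀ : ℝ} {m : ℝ → ℝ} (hm : IsIMultiplier N C₀ m) (hN : 0 < N)
    {ξ : ℝ} (hξ : 2 * N ≤ |ξ|) : m ξ ^ 2 = N / |ξ| := by
  have h0 : 0 < |ξ| := by linarith
  rw [hm.2.2.2.2.2.1 ξ hξ, ← Real.rpow_natCast, ← Real.rpow_mul (by positivity)]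
  norm_num [Real.rpow_neg_one]

theorem IsIMultiplier.le_two_mul_sq {N C₀ : ℝ} {m : ℝ → ℝ} (hm : IsIMultiplier N C₀ m)
    (hN : 0 < N) {ξ X : ℝ} (hX : N ≤ X) (hξ : |ξ| ≤ X) : N ≤ 2 * X * m ξ ^ 2 := by
  rcases le_total |ξ| N with h | h
  · rw [hm.2.2.2.2.1 ξ h]; linarith
  rcases le_total |ξ| (2 * N) with h' | h'
  · have h1 : m (2 * N) ≤ m ξ := by
      rw [← hm.abs_eq ξ]; exact hm.2.2.2.1 _ _ (abs_nonneg _) h'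
    have h2 : m (2 * N) ^ 2 = 1 / 2 := by
      have : |2 * N| = 2 * N := abs_of_pos (by linarith)
      rw [hm.sq_eq hN this.ge, this]; field_simp
    have h3 : m (2 * N) ^ 2 ≤ m ξ ^ 2 := pow_le_pow_left₀ (hm.nonneg _) h1 2
    nlinarith
  · have h0 : 0 < |ξ| := by linarith
    rw [hm.sq_eq hN h', mul_div_assoc', le_div_iff₀ h0]
    nlinarith

theorem IsIMultiplier.le_two_mul_mul {N C₀ : ℝ} {m : ℝ → ℝ} (hm : IsIMultiplier N C₀ m)
    (hN : 0 < N) {a b X : ℝ} (hX : N ≤ X) (ha : |a| ≤ X) (hb : |b| ≤ X) :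
    N ≤ 2 * X * (m a * m b) := by
  have hX0 : 0 ≤ X := by linarith
  rcases le_total (m a) (m b) with h | h
  · refine (hm.le_two_mul_sq hN hX ha).trans ?_
    gcongr
    rw [sq]
    exact mul_le_mul_of_nonneg_left h (hm.nonneg a)
  · refine (hm.le_two_mul_sq hN hX hb).trans ?_
    gcongr
    rw [sq]
    exact mul_le_mul_of_nonneg_right h (hm.nonneg b)

theorem IsIMultiplier.contDiff_sq {N C₀ : ℝ} {m : ℝ → ℝ} (hm : IsIMultiplier N C₀ m) :
    ContDiff ℝ 2 (fun x => m x ^ 2) :=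
  (contDiff_infty.1 hm.1 2).pow 2

theorem IsIMultiplier.abs_sub_sq_mul_le {N C₀ : ℝ} {m : ℝ → ℝ} (hm : IsIMultiplier N C₀ m)
    (hN : 0 < N) (hC₀ : 0 < C₀) (a b : ℝ) :
    |m a ^ 2 - m b ^ 2| * max N (max |a| |b|) ≤ (2 + 2 * C₀) * |a - b| := by
  wlog hab : |b| ≤ |a| generalizing a b
  · rw [abs_sub_comm, abs_sub_comm a b, max_comm |a|]
    exact this b a (le_of_not_ge hab)
  rw [max_eq_left hab]
  rcases le_total |a| N with h | h
  · rw [hm.2.2.2.2.1 a h, hm.2.2.2.2.1 b (hab.trans h)]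
    simp; positivity
  rw [max_eq_right h]
  have ha0 : 0 < |a| := by linarith
  rcases le_total (|a| / 2) |a - b| with h1 | h1
  · have h2 : |m a ^ 2 - m b ^ 2| ≤ 1 := by
      rw [abs_le]
      constructor <;> linarith [hm.sq_le_one a, hm.sq_le_one b, sq_nonneg (m a), sq_nonneg (m b)]
    have := mul_le_mul_of_nonneg_right h2 ha0.le
    nlinarith [abs_nonneg (a - b)]
  · have hseg : ∀ ξ ∈ segment ℝ b a, ‖deriv (fun x => m x ^ 2) ξ‖ ≤ 2 * C₀ / |a| := by
      intro ξ hξ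
      have h3 : |a| / 2 ≤ |ξ| := by
        have h4 : |a - ξ| ≤ |a - b| := by
          rw [segment_eq_uIcc] at hξ
          exact Set.abs_sub_right_of_mem_uIcc hξ
        have := abs_sub_abs_le_abs_sub a ξ
        linarith
      have hξ0 : 0 < |ξ| := by linarith
      refine (hm.2.2.2.2.2.2.1 ξ (abs_pos.1 hξ0)).trans ?_
      rw [div_le_div_iff₀ hξ0 ha0]
      have := hm.sq_le_one ξ
      have h5 : C₀ * m ξ ^ 2 ≤ C₀ := by nlinarith
      nlinarith
    have := (convex_segment b a).norm_image_sub_le_of_norm_deriv_le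
      (fun ξ _ => (hm.contDiff_sq.differentiable (by norm_num)) ξ) hseg
      (left_mem_segment ℝ b a) (right_mem_segment ℝ b a)
    simp only [Real.norm_eq_abs] at this
    calc _ ≤ 2 * C₀ / |a| * |a - b| * |a| := by gcongr
      _ = 2 * C₀ * |a - b| := by field_simp
      _ ≤ _ := by nlinarith [abs_nonneg (a - b)]

theorem IsIMultiplier.abs_diff_mul_le_of_le {N C₀ : ℝ} {m : ℝ → ℝ} (hm : IsIMultiplier N C₀ m)
    (hN : 0 < N) (hC₀ : 0 < C₀) {a b c d : ℝ} (h : a + c = b + d) (hpq : |a - b| ≤ |a - d|) :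
    |m a ^ 2 - m b ^ 2 + m c ^ 2 - m d ^ 2| * max N (max |a| |b|) * max N (max |c| |d|) ≤
      (16 + 16 * C₀) * (|a - b| * |a - d|) := by
  have hab := hm.abs_sub_sq_mul_le hN hC₀ a b
  have hcd := hm.abs_sub_sq_mul_le hN hC₀ c d
  set X := max N (max |a| |b|) with hX
  set Y := max N (max |c| |d|) with hY
  have hNX : N ≤ X := le_max_left _ _
  have hNY : N ≤ Y := le_max_left _ _
  have haX : |a| ≤ X := (le_max_left _ _).trans (le_max_right _ _)
  have hbX : |b| ≤ X := (le_max_right _ _).trans (le_max_right _ _)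
  have hcY : |c| ≤ Y := (le_max_left _ _).trans (le_max_right _ _)
  have hdY : |d| ≤ Y := (le_max_right _ _).trans (le_max_right _ _)
  have hcd' : |c - d| = |a - b| := by
    rw [abs_sub_comm c d]; congr 1; linarith
  rw [hcd'] at hcd
  have hp := abs_nonneg (a - b)
  have hq := abs_nonneg (a - d)
  rcases le_total (max X Y) (4 * |a - d|) with hlarge | hsmall
  · have hXq := (le_max_left X Y).trans hlarge
    have hYq := (le_max_right X Y).trans hlarge
    have htri : |m a ^ 2 - m b ^ 2 + m c ^ 2 - m d ^ 2| ≤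
        |m a ^ 2 - m b ^ 2| + |m c ^ 2 - m d ^ 2| := by
      rw [add_sub_assoc]; exact abs_add_le _ _
    have hX0 : 0 ≤ X := hN.le.trans hNX
    have hY0 : 0 ≤ Y := hN.le.trans hNY
    calc _ ≤ (|m a ^ 2 - m b ^ 2| + |m c ^ 2 - m d ^ 2|) * X * Y := by gcongr
      _ = |m a ^ 2 - m b ^ 2| * X * Y + |m c ^ 2 - m d ^ 2| * Y * X := by ring
      _ ≤ (2 + 2 * C₀) * |a - b| * (4 * |a - d|) + (2 + 2 * C₀) * |a - b| * (4 * |a - d|) := by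
        gcongr
      _ = _ := by ring
  · set M := max X Y with hM
    have hXM : X ≤ M := le_max_left _ _
    have hYM : Y ≤ M := le_max_right _ _
    rcases eq_or_lt_of_le (hNX.trans hXM) with hMN | hMN
    · rw [hm.2.2.2.2.1 a (by linarith), hm.2.2.2.2.1 b (by linarith),
        hm.2.2.2.2.1 c (by linarith), hm.2.2.2.2.1 d (by linarith)]
      simp; positivity
    have hx : ∃ x, |x| = M ∧ (x = a ∨ x = b ∨ x = c ∨ x = d) := by
      rcases max_choice X Y with h1 | h1
      · rcases max_choice N (max |a| |b|) with h2 | h2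
        · rw [← hX] at h2; linarith
        · rcases max_choice |a| |b| with h3 | h3
          · exact ⟨a, by rw [hM, h1, hX, h2, h3], by simp⟩
          · exact ⟨b, by rw [hM, h1, hX, h2, h3], by simp⟩
      · rcases max_choice N (max |c| |d|) with h2 | h2
        · rw [← hY] at h2; linarith
        · rcases max_choice |c| |d| with h3 | h3
          · exact ⟨c, by rw [hM, h1, hY, h2, h3], by simp⟩
          · exact ⟨d, by rw [hM, h1, hY, h2, h3], by simp⟩
    obtain ⟨x, hxM, hx⟩ := hx
    have hM0 : 0 < M := hN.trans hMN
    have hK : ∀ ξ ∈ Set.Icc (x - M / 2) (x + M / 2),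
        |deriv (deriv fun x => m x ^ 2) ξ| ≤ 4 * C₀ / M ^ 2 := by
      intro ξ hξ
      have h4 : |x - ξ| ≤ M / 2 := abs_le.2 ⟨by linarith [hξ.2], by linarith [hξ.1]⟩
      have h3 : M / 2 ≤ |ξ| := by linarith [abs_sub_abs_le_abs_sub x ξ]
      have hξ0 : 0 < |ξ| := by linarith
      refine (hm.2.2.2.2.2.2.2 ξ (abs_pos.1 hξ0)).trans ?_
      rw [← sq_abs ξ, div_le_div_iff₀ (by positivity) (by positivity)]
      have h5 : C₀ * m ξ ^ 2 ≤ C₀ := by nlinarith [hm.sq_le_one ξ]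
      have h6 : M ^ 2 ≤ 4 * |ξ| ^ 2 := by nlinarith
      calc C₀ * m ξ ^ 2 * M ^ 2 ≤ C₀ * (4 * |ξ| ^ 2) := by gcongr
        _ = _ := by ring
    obtain ⟨p1, p2⟩ := abs_le.1 (le_refl |a - b|)
    obtain ⟨q1, q2⟩ := abs_le.1 (le_refl |a - d|)
    have hnum := abs_parallelogram_diff_le (r := M / 2) hm.contDiff_sq hK h
      (by constructor <;> rcases hx with rfl | rfl | rfl | rfl <;> linarith)
      (by constructor <;> rcases hx with rfl | rfl | rfl | rfl <;> linarith)
      (by constructor <;> rcases hx with rfl | rfl | rfl | rfl <;> linarith)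
      (by constructor <;> rcases hx with rfl | rfl | rfl | rfl <;> linarith)
    have hX0 : 0 ≤ X := hN.le.trans hNX
    have hY0 : 0 ≤ Y := hN.le.trans hNY
    calc _ ≤ (4 * C₀ / M ^ 2 * |a - b| * |a - d|) * M * M := by gcongr
      _ = 4 * C₀ * (|a - b| * |a - d|) := by field_simp
      _ ≤ _ := by gcongr; linarith

theorem IsIMultiplier.sq_mul_abs_diff_le {N C₀ : ℝ} {m : ℝ → ℝ} (hm : IsIMultiplier N C₀ m)
    (hN : 0 < N) (hC₀ : 0 < C₀) {a b c d : ℝ} (h : a + c = b + d) :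
    N ^ 2 * |m a ^ 2 - m b ^ 2 + m c ^ 2 - m d ^ 2| ≤
      (64 + 64 * C₀) * (|a - b| * |a - d|) * (m a * m b * m c * m d) := by
  wlog hpq : |a - b| ≤ |a - d| generalizing b d
  · have := this (b := d) (d := b) (by linarith) (le_of_not_ge hpq)
    convert this using 1
    · congr 2; ring
    · ring
  have h1 := hm.abs_diff_mul_le_of_le hN hC₀ h hpq
  have hab := hm.le_two_mul_mul hN (le_max_left N (max |a| |b|))
    ((le_max_left |a| |b|).trans (le_max_right _ _))
    ((le_max_right |a| |b|).trans (le_max_right _ _))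
  have hcd := hm.le_two_mul_mul hN (le_max_left N (max |c| |d|))
    ((le_max_left |c| |d|).trans (le_max_right _ _))
    ((le_max_right |c| |d|).trans (le_max_right _ _))
  set X := max N (max |a| |b|)
  set Y := max N (max |c| |d|)
  have := hm.nonneg a
  have := hm.nonneg b
  have := hm.nonneg c
  have := hm.nonneg d
  have h2 : N * N ≤ (2 * X * (m a * m b)) * (2 * Y * (m c * m d)) :=
    mul_le_mul hab hcd hN.le (hN.le.trans hab)
  calc _ = N * N * |m a ^ 2 - m b ^ 2 + m c ^ 2 - m d ^ 2| := by ring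
    _ ≤ (2 * X * (m a * m b)) * (2 * Y * (m c * m d)) *
        |m a ^ 2 - m b ^ 2 + m c ^ 2 - m d ^ 2| := by gcongr
    _ = (|m a ^ 2 - m b ^ 2 + m c ^ 2 - m d ^ 2| * X * Y) * (4 * (m a * m b * m c * m d)) := by
      ring
    _ ≤ (16 + 16 * C₀) * (|a - b| * |a - d|) * (4 * (m a * m b * m c * m d)) := by gcongr
    _ = _ := by ring

/-- Pointwise bound on `σ₄` on the hyperplane of integration. -/
theorem IsIMultiplier.abs_sigma4_le {N C₀ : ℝ} {m : ℝ → ℝ} (hm : IsIMultiplier N C₀ m)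
    (hN : 1 ≤ N) (hC₀ : 0 < C₀) {a b c d : ℝ} (h : a + c = b + d) :
    |sigma4 m a b c d| ≤ (128 + 128 * C₀) * (m a * m b * m c * m d) *
      ((√(1 + a ^ 2))⁻¹ * (√(1 + c ^ 2))⁻¹) := by
  have := hm.nonneg a
  have := hm.nonneg b
  have := hm.nonneg c
  have := hm.nonneg d
  have hrhs : 0 ≤ (128 + 128 * C₀) * (m a * m b * m c * m d) *
      ((√(1 + a ^ 2))⁻¹ * (√(1 + c ^ 2))⁻¹) := by positivity
  unfold sigma4
  split_ifs with hD
  · simpa using hrhs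
  by_cases hsmall : |a| ≤ N ∧ |b| ≤ N ∧ |c| ≤ N ∧ |d| ≤ N
  · obtain ⟨ha, hb, hc, hd⟩ := hsmall
    have := hm.2.2.2.2.1
    rw [this a ha, this b hb, this c hc, this d hd] at hrhs ⊢
    simpa using hrhs
  set Q := (6 * (a + c) ^ 2 + (a - c) ^ 2 + (b - d) ^ 2) / 2 with hQ
  have hd : d = a + c - b := by linarith
  have hDQ : a ^ 4 - b ^ 4 + c ^ 4 - d ^ 4 = (a - b) * (a - d) * Q := by
    rw [hQ, hd]; ring
  have haQ : a ^ 2 ≤ Q := by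
    rw [hQ, hd]; nlinarith [sq_nonneg (a + c), sq_nonneg (a - c), sq_nonneg (b - d)]
  have hcQ : c ^ 2 ≤ Q := by
    rw [hQ, hd]; nlinarith [sq_nonneg (a + c), sq_nonneg (a - c), sq_nonneg (b - d)]
  have hbQ : b ^ 2 ≤ Q := by
    rw [hQ, hd]
    nlinarith [sq_nonneg (a + c), sq_nonneg (a - c), sq_nonneg (b - (a + c - b) - (a + c))]
  have hdQ : d ^ 2 ≤ Q := by
    have : a + c = b + d := h
    rw [hQ, this]; nlinarith [sq_nonneg (b + d), sq_nonneg (a - c), sq_nonneg (b - d)]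
  have hQ1 : 1 ≤ Q := by
    have key : ∀ t : ℝ, t ^ 2 ≤ Q → ¬ |t| ≤ N → 1 ≤ Q := by
      intro t ht htN
      rw [← sq_abs] at ht
      nlinarith
    by_contra hcon
    exact hsmall ⟨by_contra fun h' => hcon (key a haQ h'), by_contra fun h' => hcon (key b hbQ h'),
      by_contra fun h' => hcon (key c hcQ h'), by_contra fun h' => hcon (key d hdQ h')⟩
  have hQ0 : 0 < Q := by linarith
  have hpq : 0 < |a - b| * |a - d| := by
    rw [← abs_mul, abs_pos]
    intro h0
    apply hD
    rw [hDQ, h0, zero_mul]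
  have hsq : √(1 + a ^ 2) * √(1 + c ^ 2) ≤ 2 * Q := by
    rw [← Real.sqrt_mul (by positivity), Real.sqrt_le_left (by positivity)]
    have h1 : 1 + a ^ 2 ≤ 2 * Q := by linarith
    have h2 : 1 + c ^ 2 ≤ 2 * Q := by linarith
    calc (1 + a ^ 2) * (1 + c ^ 2) ≤ (2 * Q) * (2 * Q) := by gcongr
      _ = _ := by ring
  have hnum := hm.sq_mul_abs_diff_le (by linarith) hC₀ h
  have hnum' : |m a ^ 2 - m b ^ 2 + m c ^ 2 - m d ^ 2| ≤
      (64 + 64 * C₀) * (|a - b| * |a - d|) * (m a * m b * m c * m d) := by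
    refine le_trans ?_ hnum
    exact le_mul_of_one_le_left (abs_nonneg _) (one_le_pow₀ hN)
  rw [hDQ, abs_div, abs_mul, abs_mul, abs_of_pos hQ0, div_le_iff₀ (by positivity), ← mul_inv]
  refine hnum'.trans ?_
  have hs0 : 0 < √(1 + a ^ 2) * √(1 + c ^ 2) := by positivity
  have h1 : 1 ≤ (√(1 + a ^ 2) * √(1 + c ^ 2))⁻¹ * (2 * Q) := by
    rw [inv_mul_eq_div, le_div_iff₀ hs0]; linarith
  calc _ ≤ (64 + 64 * C₀) * (|a - b| * |a - d|) * (m a * m b * m c * m d) *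
        ((√(1 + a ^ 2) * √(1 + c ^ 2))⁻¹ * (2 * Q)) := le_mul_of_one_le_right (by positivity) h1
    _ = _ := by ring

open FourierTransform in
theorem continuous_fourier_of_integrable {f : ℝ → ℂ} (hf : Integrable f) :
    Continuous (𝓕 f) :=
  VectorFourier.fourierIntegral_continuous Real.continuous_fourierChar
    (L := innerₗ ℝ) continuous_inner hf

open FourierTransform SchwartzMap in
/-- The `L²` Fourier transform agrees with the Fourier integral on `L¹ ∩ L²`. -/
theorem fourier_toLp_ae_eq {f : ℝ → ℂ} (hf : Integrable f) (hf2 : MemLp f 2) :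
    (𝓕 (hf2.toLp f) : Lp ℂ 2 (volume : Measure ℝ)) =ᵐ[volume] 𝓕 f := by
  apply ae_eq_of_integral_contDiff_smul_eq
  · exact (Lp.memLp _).locallyIntegrable (by norm_num)
  · exact (continuous_fourier_of_integrable hf).locallyIntegrable
  intro g g_smooth g_cpt
  have hg₁ : HasCompactSupport (Complex.ofRealCLM ∘ g) := g_cpt.comp_left rfl
  have hg₂ : ContDiff ℝ (⊤ : ℕ∞) (Complex.ofRealCLM ∘ g) := by fun_prop
  set φ : 𝓢(ℝ, ℂ) := hg₁.toSchwartzMap hg₂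
  have h1 : 𝓕 ((hf2.toLp f : Lp ℂ 2 (volume : Measure ℝ)) : 𝓢'(ℝ, ℂ)) φ
      = ((𝓕 (hf2.toLp f) : Lp ℂ 2 (volume : Measure ℝ)) : 𝓢'(ℝ, ℂ)) φ := by
    rw [Lp.fourier_toTemperedDistribution_eq]
  rw [TemperedDistribution.fourier_apply, Lp.toTemperedDistribution_apply,
    Lp.toTemperedDistribution_apply] at h1
  have h2 : ∫ x, (𝓕 φ) x • (hf2.toLp f) x = ∫ x, (𝓕 φ) x • f x := by
    apply integral_congr_ae
    filter_upwards [hf2.coeFn_toLp] with x hx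
    rw [hx]
  have h3 : ∫ x, (𝓕 φ) x • f x = ∫ x, φ x • 𝓕 f x := by
    simpa [SchwartzMap.fourier_coe] using!
      (VectorFourier.integral_fourierIntegral_smul_eq_flip (L := innerₗ ℝ)
        Real.continuous_fourierChar continuous_inner φ.integrable hf)
  have h4 : ∀ x (z : ℂ), g x • z = φ x • z := by
    intro x z
    change g x • z = ((g x : ℝ) : ℂ) • z
    simp
  simp_rw [h4]
  rw [← h1, h2, h3]

open FourierTransform in
/-- **Plancherel's theorem** on `L¹ ∩ L²`. -/
theorem integral_norm_sq_fourier {f : ℝ → ℂ} (hf : Integrable f) (hf2 : MemLp f 2) :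
    ∫ x, ‖𝓕 f x‖ ^ 2 = ∫ x, ‖f x‖ ^ 2 := by
  have hL2 : ∀ g : Lp ℂ 2 (volume : Measure ℝ), ∫ x, ‖g x‖ ^ 2 = ‖g‖ ^ 2 := by
    intro g
    have := L2.inner_def (𝕜 := ℂ) g g
    have h := congrArg Complex.re this
    rw [inner_self_eq_norm_sq_to_K] at h
    simp_rw [inner_self_eq_norm_sq_to_K] at h
    norm_cast at h
    exact_mod_cast h.symm
  have e1 : ∫ x, ‖𝓕 f x‖ ^ 2 = ‖(𝓕 (hf2.toLp f) : Lp ℂ 2 (volume : Measure ℝ))‖ ^ 2 := by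
    rw [← hL2]
    apply integral_congr_ae
    filter_upwards [fourier_toLp_ae_eq hf hf2] with x hx
    rw [hx]
  have e2 : ∫ x, ‖f x‖ ^ 2 = ‖hf2.toLp f‖ ^ 2 := by
    rw [← hL2]
    apply integral_congr_ae
    filter_upwards [hf2.coeFn_toLp] with x hx
    rw [hx]
  rw [e1, e2, Lp.norm_fourier_eq]

open ENNReal in
theorem lintegral_mul_sq_le {f g : ℝ → ℝ≥0∞} (hf : Measurable f) (hg : Measurable g) :
    (∫⁻ x, f x * g x) ^ 2 ≤ (∫⁻ x, f x ^ 2) * ∫⁻ x, g x ^ 2 := by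
  have h := ENNReal.lintegral_mul_le_Lp_mul_Lq volume Real.HolderConjugate.two_two
    hf.aemeasurable hg.aemeasurable
  simp only [Pi.mul_apply, ENNReal.rpow_ofNat] at h
  refine (pow_le_pow_left' h 2).trans ?_
  rw [mul_pow, ← ENNReal.rpow_natCast, ← ENNReal.rpow_natCast, ← ENNReal.rpow_mul,
    ← ENNReal.rpow_mul]
  norm_num

open ENNReal in
theorem lintegral_quadrilinear_le {Φ w : ℝ → ℝ≥0∞} (hΦ : Measurable Φ) (hw : Measurable w) :
    ∫⁻ v : ℝ × ℝ × ℝ, w v.1 * w v.2.2 *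
        (Φ v.1 * Φ (-v.2.1) * Φ v.2.2 * Φ (v.1 + v.2.1 + v.2.2)) ≤
      2 * (∫⁻ x, w x ^ 2) * (∫⁻ x, Φ x ^ 2) ^ 2 := by
  set A := ∫⁻ x, Φ x ^ 2 with hA
  have hpt : ∀ x y : ℝ≥0∞, x * y ≤ x ^ 2 + y ^ 2 := by
    intro x y
    rcases le_total x y with h | h
    · calc x * y ≤ y * y := by gcongr
        _ ≤ _ := by rw [← sq]; exact le_add_self
    · calc x * y ≤ x * x := by gcongr
        _ ≤ _ := by rw [← sq]; exact le_self_add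
  have hinner : ∀ a c : ℝ, ∫⁻ b, (Φ (-b) ^ 2 + Φ (a + b + c) ^ 2) = 2 * A := by
    intro a c
    rw [lintegral_add_left (by fun_prop)]
    have h1 : ∫⁻ b, Φ (-b) ^ 2 = A := lintegral_neg_eq_self (fun x => Φ x ^ 2)
    have h2 : ∫⁻ b, Φ (a + b + c) ^ 2 = A := by
      have : ∀ b, a + b + c = b + (a + c) := fun b => by ring
      simp_rw [this]
      exact lintegral_add_right_eq_self (fun x => Φ x ^ 2) (a + c)
    rw [h1, h2, two_mul]
  calc _ ≤ ∫⁻ v : ℝ × ℝ × ℝ, (w v.1 * Φ v.1) * ((w v.2.2 * Φ v.2.2) *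
        (Φ (-v.2.1) ^ 2 + Φ (v.1 + v.2.1 + v.2.2) ^ 2)) := by
        apply lintegral_mono
        intro v
        calc _ = (w v.1 * Φ v.1) * ((w v.2.2 * Φ v.2.2) *
              (Φ (-v.2.1) * Φ (v.1 + v.2.1 + v.2.2))) := by ring
          _ ≤ _ := mul_le_mul' le_rfl (mul_le_mul' le_rfl (hpt _ _))
    _ = ∫⁻ a, (w a * Φ a) * ∫⁻ c, (w c * Φ c) * (2 * A) := by
        rw [Measure.volume_eq_prod, lintegral_prod _ (by fun_prop)]
        congr with a
        dsimp only
        rw [lintegral_const_mul _ (by fun_prop), Measure.volume_eq_prod,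
          lintegral_prod_symm _ (by fun_prop)]
        congr 2 with c
        dsimp only
        rw [lintegral_const_mul _ (by fun_prop), hinner]
    _ = 2 * A * (∫⁻ a, w a * Φ a) ^ 2 := by
        rw [lintegral_mul_const _ (by fun_prop), lintegral_mul_const _ (by fun_prop)]
        ring
    _ ≤ 2 * A * ((∫⁻ x, w x ^ 2) * A) := by
        gcongr
        exact lintegral_mul_sq_le hw hΦ
    _ = _ := by ring

theorem lintegral_inv_sqrt_one_add_sq :
    ∫⁻ x : ℝ, ENNReal.ofReal ((√(1 + x ^ 2))⁻¹) ^ 2 = ENNReal.ofReal Real.pi := by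
  rw [← integral_univ_inv_one_add_sq,
    ofReal_integral_eq_lintegral_ofReal integrable_inv_one_add_sq
      (Filter.Eventually.of_forall fun x => by positivity)]
  congr with x
  rw [← ENNReal.ofReal_pow (by positivity), inv_pow, Real.sq_sqrt (by positivity)]

open FourierTransform in
theorem fourierInt_two_pi_mul (u : ℝ → ℂ) (ξ : ℝ) :
    fourierInt u (2 * Real.pi * ξ) = 𝓕 u ξ := by
  rw [Real.fourier_real_eq_integral_exp_smul, fourierInt]
  congr with x
  rw [smul_eq_mul]
  congr 2
  push_cast
  ring

open FourierTransform in
theorem Iop_eq_fourier (m : ℝ → ℝ) (u : ℝ → ℂ) (x : ℝ) :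
    Iop m u x = 𝓕 (fun η => (m (2 * Real.pi * η) : ℂ) * 𝓕 u η) (-x) := by
  have h := Measure.integral_comp_mul_left
    (fun ξ : ℝ => Complex.exp (Complex.I * x * ξ) * (m ξ : ℂ) * fourierInt u ξ) (2 * Real.pi)
  rw [Real.fourier_real_eq_integral_exp_smul, Iop]
  rw [abs_of_pos (by positivity), Complex.real_smul] at h
  push_cast at h ⊢
  rw [← h]
  congr with η
  rw [← Complex.ofReal_ofNat, ← Complex.ofReal_mul, ← Complex.ofReal_mul,
    fourierInt_two_pi_mul, smul_eq_mul, mul_assoc]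
  congr 2
  push_cast
  ring

theorem memLp_of_bounded_mul {m : ℝ → ℝ} (hm : Continuous m) (hm1 : ∀ ξ, |m ξ| ≤ 1)
    (v : SchwartzMap ℝ ℂ) (p : ENNReal) :
    MemLp (fun η => (m η : ℂ) * v η) p := by
  have hc : Continuous fun η => (m η : ℂ) * v η :=
    (Complex.continuous_ofReal.comp hm).mul v.continuous
  refine (v.memLp p).of_le hc.aestronglyMeasurable (Filter.Eventually.of_forall fun η => ?_)
  rw [norm_mul, Complex.norm_real, Real.norm_eq_abs]
  exact mul_le_of_le_one_left (norm_nonneg _) (hm1 η)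

theorem continuous_fourierInt (u : SchwartzMap ℝ ℂ) : Continuous (fourierInt (fun y => u y)) := by
  have h : fourierInt (fun y => u y) =
      fun ξ => FourierTransform.fourier (fun y => u y) ((2 * Real.pi)⁻¹ * ξ) := by
    funext ξ
    rw [← fourierInt_two_pi_mul, mul_inv_cancel_left₀ (by positivity)]
  rw [h]
  exact (continuous_fourier_of_integrable u.integrable).comp (by fun_prop)

open FourierTransform in
theorem IsIMultiplier.lintegral_enorm_sq {N C₀ : ℝ} {m : ℝ → ℝ} (hm : IsIMultiplier N C₀ m)
    (u : SchwartzMap ℝ ℂ) :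
    ∫⁻ ξ, ‖(m ξ : ℂ) * fourierInt (fun y => u y) ξ‖ₑ ^ 2 =
      ENNReal.ofReal (2 * Real.pi * ∫ x : ℝ, ‖Iop m (fun y => u y) x‖ ^ 2) := by
  set H : ℝ → ℂ := fun η => (m (2 * Real.pi * η) : ℂ) * 𝓕 (fun y => u y) η with hH
  have hHp : ∀ p, MemLp H p := fun p =>
    memLp_of_bounded_mul (m := fun η => m (2 * Real.pi * η))
      (hm.1.continuous.comp (by fun_prop))
      (fun ξ => by rw [abs_of_nonneg (hm.nonneg _)]; exact hm.le_one _) (𝓕 u) p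
  have hI : ∫ x : ℝ, ‖Iop m (fun y => u y) x‖ ^ 2 = ∫ η, ‖H η‖ ^ 2 := by
    simp_rw [Iop_eq_fourier]
    rw [integral_neg_eq_self (fun x => ‖𝓕 H x‖ ^ 2)]
    exact integral_norm_sq_fourier (memLp_one_iff_integrable.1 (hHp 1)) (hHp 2)
  set g : ℝ → ℝ := fun ξ => ‖(m ξ : ℂ) * fourierInt (fun y => u y) ξ‖ ^ 2 with hg
  have hgH : ∀ η, g (2 * Real.pi * η) = ‖H η‖ ^ 2 := by
    intro η
    simp only [hg, hH, fourierInt_two_pi_mul]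
  have hgint : Integrable g := by
    rw [← integrable_comp_mul_left_iff g (R := 2 * Real.pi) (by positivity)]
    simp_rw [hgH]
    exact (hHp 2).integrable_norm_pow (by norm_num)
  have hscale := Measure.integral_comp_mul_left g (2 * Real.pi)
  simp_rw [hgH] at hscale
  rw [hI, hscale, abs_of_pos (by positivity), smul_eq_mul, mul_inv_cancel_left₀ (by positivity),
    ofReal_integral_eq_lintegral_ofReal hgint (Filter.Eventually.of_forall fun x => by positivity)]
  congr with ξ
  rw [hg, ENNReal.ofReal_pow (norm_nonneg _), ofReal_norm]

/-- The modified energies `E_I⁴` and `E_I²` differ by `O(‖Iu‖_{L²}⁴)`: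
`|Λ₄(σ₄; u)| ≤ C ‖Iu‖_{L²}⁴`, where `ŵ(ξ) = conj(û(-ξ))` and
`Λ₄(σ₄;u) = ∫_{ℝ³} σ₄(ξ₁,ξ₂,ξ₃,−ξ₁−ξ₂−ξ₃) û(ξ₁) ŵ(ξ₂) û(ξ₃) ŵ(−ξ₁−ξ₂−ξ₃)`.
(Here `‖Iu‖_{L²}⁴ = (∫ |Iu|²)²`.) -/
theorem stmt_13 (C₀ : ℝ) (hC₀ : 0 < C₀) :
    ∃ C > (0:ℝ), ∀ N : ℝ, 1 ≤ N → ∀ m : ℝ → ℝ, IsIMultiplier N C₀ m →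
      ∀ u : SchwartzMap ℝ ℂ,
        ‖∫ v : ℝ × ℝ × ℝ,
            (sigma4 m v.1 v.2.1 v.2.2 (-v.1 - v.2.1 - v.2.2) : ℂ) *
              fourierInt (fun y => u y) v.1 *
              (starRingEnd ℂ) (fourierInt (fun y => u y) (-v.2.1)) *
              fourierInt (fun y => u y) v.2.2 *
              (starRingEnd ℂ) (fourierInt (fun y => u y) (v.1 + v.2.1 + v.2.2))‖ ≤
          C * (∫ x : ℝ, ‖Iop m (fun y => u y) x‖^2)^2 := by
  refine ⟨(128 + 128 * C₀) * 8 * Real.pi ^ 3, by positivity, ?_⟩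
  intro N hN m hm u
  set J := ∫ x : ℝ, ‖Iop m (fun y => u y) x‖ ^ 2
  have hJ0 : 0 ≤ J := integral_nonneg fun x => by positivity
  have hmc : Continuous m := hm.1.continuous
  have huc : Continuous (fourierInt (fun y => u y)) := continuous_fourierInt u
  set û := fourierInt (fun y => u y)
  let Φ : ℝ → ENNReal := fun ξ => ‖(m ξ : ℂ) * û ξ‖ₑ
  let w : ℝ → ENNReal := fun x => ENNReal.ofReal ((√(1 + x ^ 2))⁻¹)
  have hΦ : Measurable Φ :=
    (((Complex.continuous_ofReal.comp hmc).mul huc).enorm).measurable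
  have hw : Measurable w := by fun_prop
  have hA : ∫⁻ ξ, Φ ξ ^ 2 = ENNReal.ofReal (2 * Real.pi * J) :=
    hm.lintegral_enorm_sq u
  have hpt : ∀ v : ℝ × ℝ × ℝ,
      ‖(sigma4 m v.1 v.2.1 v.2.2 (-v.1 - v.2.1 - v.2.2) : ℂ) * û v.1 *
        (starRingEnd ℂ) (û (-v.2.1)) * û v.2.2 * (starRingEnd ℂ) (û (v.1 + v.2.1 + v.2.2))‖ₑ ≤
      ENNReal.ofReal (128 + 128 * C₀) * (w v.1 * w v.2.2 *
        (Φ v.1 * Φ (-v.2.1) * Φ v.2.2 * Φ (v.1 + v.2.1 + v.2.2))) := by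
    rintro ⟨a, b, c⟩
    have h1 := hm.abs_sigma4_le hN hC₀ (a := a) (b := -b) (c := c) (d := a + b + c) (by ring)
    have h2 : sigma4 m a (-b) c (a + b + c) = sigma4 m a b c (-a - b - c) := by
      have e : -a - b - c = -(a + b + c) := by ring
      simp only [sigma4, e, hm.2.1, Even.neg_pow (by decide : Even 4)]
    rw [h2] at h1
    have key : ‖(sigma4 m a b c (-a - b - c) : ℂ) * û a *
        (starRingEnd ℂ) (û (-b)) * û c * (starRingEnd ℂ) (û (a + b + c))‖ ≤
        (128 + 128 * C₀) * ((√(1 + a ^ 2))⁻¹ * (√(1 + c ^ 2))⁻¹ *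
        (‖(m a : ℂ) * û a‖ * ‖(m (-b) : ℂ) * û (-b)‖ * ‖(m c : ℂ) * û c‖ *
          ‖(m (a + b + c) : ℂ) * û (a + b + c)‖)) := by
      simp only [norm_mul, RCLike.norm_conj, Complex.norm_real, Real.norm_eq_abs,
        abs_of_nonneg (hm.nonneg _)]
      calc _ = |sigma4 m a b c (-a - b - c)| *
            (‖û a‖ * ‖û (-b)‖ * ‖û c‖ * ‖û (a + b + c)‖) := by ring
        _ ≤ ((128 + 128 * C₀) * (m a * m (-b) * m c * m (a + b + c)) *
              ((√(1 + a ^ 2))⁻¹ * (√(1 + c ^ 2))⁻¹)) *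
            (‖û a‖ * ‖û (-b)‖ * ‖û c‖ * ‖û (a + b + c)‖) := by gcongr
        _ = _ := by ring
    have := ENNReal.ofReal_le_ofReal key
    rw [ofReal_norm] at this
    refine this.trans_eq ?_
    simp only [Φ, w]
    rw [ENNReal.ofReal_mul (by positivity), ENNReal.ofReal_mul (by positivity),
      ENNReal.ofReal_mul (by positivity), ENNReal.ofReal_mul (by positivity),
      ENNReal.ofReal_mul (by positivity), ENNReal.ofReal_mul (by positivity)]
    simp only [ofReal_norm]
  rw [← ENNReal.ofReal_le_ofReal_iff (by positivity), ofReal_norm]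
  calc _ ≤ ∫⁻ v : ℝ × ℝ × ℝ, ENNReal.ofReal (128 + 128 * C₀) * (w v.1 * w v.2.2 *
        (Φ v.1 * Φ (-v.2.1) * Φ v.2.2 * Φ (v.1 + v.2.1 + v.2.2))) :=
        (enorm_integral_le_lintegral_enorm _).trans (lintegral_mono hpt)
    _ ≤ ENNReal.ofReal (128 + 128 * C₀) *
        (2 * (∫⁻ x, w x ^ 2) * (∫⁻ x, Φ x ^ 2) ^ 2) := by
        rw [lintegral_const_mul' _ _ ENNReal.ofReal_ne_top]
        gcongr
        exact lintegral_quadrilinear_le hΦ hw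
    _ = ENNReal.ofReal ((128 + 128 * C₀) * (2 * Real.pi * (2 * Real.pi * J) ^ 2)) := by
        rw [hA, lintegral_inv_sqrt_one_add_sq, ← ENNReal.ofReal_pow (by positivity),
          ← ENNReal.ofReal_ofNat, ← ENNReal.ofReal_mul (by positivity),
          ← ENNReal.ofReal_mul (by positivity), ← ENNReal.ofReal_mul (by positivity)]
    _ = _ := by congr 1; ring
end
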